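/- arXiv:2402.15382 — 3 statements merged into one kernel-verified Lean document; each statement's English description precedes it below -/
import Mathlib

section
/- Let W be the set of all maximal J_n.lin-consistent sets of L_{[<n]}-formulas with the canonical relations <_m. Suppose x, y, z ∈ W and k < n are such that z <_k x, z <_k y, and both x and y are k-maximal. Then either x = y, or x <_m y for some m with k ≤ m < n, or y <_m x for some m with k ≤ m < n. -/
/-- Formulas of the polymodal language `L_{[<ω]}`: propositional variables,
a constant ⊤, Boolean connectives, and a modality `[m]` for each `m : ℕ`. -/
inductive Formula : Type
  | var : ℕ → Formula
  | top : Formula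
  | neg : Formula → Formula
  | and : Formula → Formula → Formula
  | or : Formula → Formula → Formula
  | imp : Formula → Formula → Formula
  | box : ℕ → Formula → Formula
  deriving DecidableEq

namespace Formula

/-- `⊥` abbreviates `¬⊤`. -/
def bot : Formula := neg top

/-- `⟨m⟩φ` abbreviates `¬[m]¬φ`. -/
def dia (m : ℕ) (φ : Formula) : Formula := neg (box m (neg φ))

/-- A formula is closed if it contains no propositional variables. -/
def Closed : Formula → Prop
  | var _ => False
  | top => True
  | neg a => Closed a
  | and a b => Closed a ∧ Closed b
  | or a b => Closed a ∧ Closed b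
  | imp a b => Closed a ∧ Closed b
  | box _ a => Closed a

/-- Membership in the language `L_{[<n]}`: all modalities `[m]` have `m < n`. -/
def InLang (n : ℕ) : Formula → Prop
  | var _ => True
  | top => True
  | neg a => InLang n a
  | and a b => InLang n a ∧ InLang n b
  | or a b => InLang n a ∧ InLang n b
  | imp a b => InLang n a ∧ InLang n b
  | box m a => m < n ∧ InLang n a

/-- Uniform substitution of formulas for propositional variables. -/
def subst (σ : ℕ → Formula) : Formula → Formula
  | var i => σ i
  | top => top
  | neg a => neg (subst σ a)
  | and a b => and (subst σ a) (subst σ b)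
  | or a b => or (subst σ a) (subst σ b)
  | imp a b => imp (subst σ a) (subst σ b)
  | box m a => box m (subst σ a)

/-- The number of occurrences of modal operators in a formula
(diamonds `⟨m⟩` are abbreviations `¬[m]¬`, so each is one box occurrence). -/
def modalCount : Formula → ℕ
  | var _ => 0
  | top => 0
  | neg a => modalCount a
  | and a b => modalCount a + modalCount b
  | or a b => modalCount a + modalCount b
  | imp a b => modalCount a + modalCount b
  | box _ a => modalCount a + 1

end Formula

/-- Conjunction of a finite list of formulas. -/
def bigConj (l : List Formula) : Formula := l.foldr Formula.and Formula.top

/-- `⋀_{m ≤ k < n} [k]φ`. -/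
def boxConj (m n : ℕ) (φ : Formula) : Formula :=
  bigConj ((List.range' m (n - m)).map fun k => Formula.box k φ)

/-- The pseudo-linearity axiom
`[m]((⋀_{m≤k<n}[k]φ) → ψ) ∨ [m]((⋀_{m≤k<n}[k]ψ ∧ ψ) → φ)`. -/
def psLin (n m : ℕ) (φ ψ : Formula) : Formula :=
  Formula.or
    (Formula.box m (Formula.imp (boxConj m n φ) ψ))
    (Formula.box m (Formula.imp (Formula.and (boxConj m n ψ) ψ) φ))

/-- A Boolean valuation of formulas respecting the Boolean connectives
(treating boxed formulas and variables as atoms). -/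
def RespectsBool (v : Formula → Bool) : Prop :=
  v Formula.top = true ∧
  (∀ a, v (Formula.neg a) = !(v a)) ∧
  (∀ a b, v (Formula.and a b) = (v a && v b)) ∧
  (∀ a b, v (Formula.or a b) = (v a || v b)) ∧
  (∀ a b, v (Formula.imp a b) = (!(v a) || v b))

/-- Propositional tautologies of the modal language. -/
def Tautology (φ : Formula) : Prop :=
  ∀ v : Formula → Bool, RespectsBool v → v φ = true

/-- Japaridze's polymodal provability logic `GLP`. -/
inductive GLP : Formula → Prop
  | taut {φ : Formula} : Tautology φ → GLP φ
  | distr (m : ℕ) (φ ψ : Formula) :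
      GLP (Formula.imp (Formula.box m (Formula.imp φ ψ))
        (Formula.imp (Formula.box m φ) (Formula.box m ψ)))
  | lob (m : ℕ) (φ : Formula) :
      GLP (Formula.imp (Formula.box m (Formula.imp (Formula.box m φ) φ)) (Formula.box m φ))
  | mono (m : ℕ) (φ : Formula) :
      GLP (Formula.imp (Formula.box m φ) (Formula.box (m + 1) φ))
  | diaMono (m : ℕ) (φ : Formula) :
      GLP (Formula.imp (Formula.dia m φ) (Formula.box (m + 1) (Formula.dia m φ)))
  | mp {φ ψ : Formula} : GLP (Formula.imp φ ψ) → GLP φ → GLP ψ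
  | nec (m : ℕ) {φ : Formula} : GLP φ → GLP (Formula.box m φ)

/-- The logic `GLP.3`: `GLP` together with the linearity axioms
`[m]([m]A → B) ∨ [m]([m]B ∧ B → A)`. -/
inductive GLP3 : Formula → Prop
  | taut {φ : Formula} : Tautology φ → GLP3 φ
  | distr (m : ℕ) (φ ψ : Formula) :
      GLP3 (Formula.imp (Formula.box m (Formula.imp φ ψ))
        (Formula.imp (Formula.box m φ) (Formula.box m ψ)))
  | lob (m : ℕ) (φ : Formula) :
      GLP3 (Formula.imp (Formula.box m (Formula.imp (Formula.box m φ) φ)) (Formula.box m φ))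
  | mono (m : ℕ) (φ : Formula) :
      GLP3 (Formula.imp (Formula.box m φ) (Formula.box (m + 1) φ))
  | diaMono (m : ℕ) (φ : Formula) :
      GLP3 (Formula.imp (Formula.dia m φ) (Formula.box (m + 1) (Formula.dia m φ)))
  | lin (m : ℕ) (A B : Formula) :
      GLP3 (Formula.or (Formula.box m (Formula.imp (Formula.box m A) B))
        (Formula.box m (Formula.imp (Formula.and (Formula.box m B) B) A)))
  | mp {φ ψ : Formula} : GLP3 (Formula.imp φ ψ) → GLP3 φ → GLP3 ψ
  | nec (m : ℕ) {φ : Formula} : GLP3 φ → GLP3 (Formula.box m φ)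

/-- The logic `GLP_n`, i.e. `GLP` restricted to the language `L_{[<n]}`. -/
inductive GLPn (n : ℕ) : Formula → Prop
  | taut {φ : Formula} : Tautology φ → Formula.InLang n φ → GLPn n φ
  | distr {m : ℕ} (hm : m < n) (φ ψ : Formula)
      (hφ : Formula.InLang n φ) (hψ : Formula.InLang n ψ) :
      GLPn n (Formula.imp (Formula.box m (Formula.imp φ ψ))
        (Formula.imp (Formula.box m φ) (Formula.box m ψ)))
  | lob {m : ℕ} (hm : m < n) (φ : Formula) (hφ : Formula.InLang n φ) :
      GLPn n (Formula.imp (Formula.box m (Formula.imp (Formula.box m φ) φ)) (Formula.box m φ))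
  | mono {m : ℕ} (hm : m + 1 < n) (φ : Formula) (hφ : Formula.InLang n φ) :
      GLPn n (Formula.imp (Formula.box m φ) (Formula.box (m + 1) φ))
  | diaMono {m : ℕ} (hm : m + 1 < n) (φ : Formula) (hφ : Formula.InLang n φ) :
      GLPn n (Formula.imp (Formula.dia m φ) (Formula.box (m + 1) (Formula.dia m φ)))
  | mp {φ ψ : Formula} : GLPn n (Formula.imp φ ψ) → GLPn n φ → GLPn n ψ
  | nec {m : ℕ} (hm : m < n) {φ : Formula} : GLPn n φ → GLPn n (Formula.box m φ)

/-- The logic `GLP_n.3`: `GLP_n` with the linearity axioms for each `m < n`. -/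
inductive GLPn3 (n : ℕ) : Formula → Prop
  | taut {φ : Formula} : Tautology φ → Formula.InLang n φ → GLPn3 n φ
  | distr {m : ℕ} (hm : m < n) (φ ψ : Formula)
      (hφ : Formula.InLang n φ) (hψ : Formula.InLang n ψ) :
      GLPn3 n (Formula.imp (Formula.box m (Formula.imp φ ψ))
        (Formula.imp (Formula.box m φ) (Formula.box m ψ)))
  | lob {m : ℕ} (hm : m < n) (φ : Formula) (hφ : Formula.InLang n φ) :
      GLPn3 n (Formula.imp (Formula.box m (Formula.imp (Formula.box m φ) φ)) (Formula.box m φ))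
  | mono {m : ℕ} (hm : m + 1 < n) (φ : Formula) (hφ : Formula.InLang n φ) :
      GLPn3 n (Formula.imp (Formula.box m φ) (Formula.box (m + 1) φ))
  | diaMono {m : ℕ} (hm : m + 1 < n) (φ : Formula) (hφ : Formula.InLang n φ) :
      GLPn3 n (Formula.imp (Formula.dia m φ) (Formula.box (m + 1) (Formula.dia m φ)))
  | lin {m : ℕ} (hm : m < n) (A B : Formula)
      (hA : Formula.InLang n A) (hB : Formula.InLang n B) :
      GLPn3 n (Formula.or (Formula.box m (Formula.imp (Formula.box m A) B))
        (Formula.box m (Formula.imp (Formula.and (Formula.box m B) B) A)))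
  | mp {φ ψ : Formula} : GLPn3 n (Formula.imp φ ψ) → GLPn3 n φ → GLPn3 n ψ
  | nec {m : ℕ} (hm : m < n) {φ : Formula} : GLPn3 n φ → GLPn3 n (Formula.box m φ)

/-- Beklemishev's logic `J_n`. -/
inductive Jn (n : ℕ) : Formula → Prop
  | taut {φ : Formula} : Tautology φ → Formula.InLang n φ → Jn n φ
  | distr {k : ℕ} (hk : k < n) (φ ψ : Formula)
      (hφ : Formula.InLang n φ) (hψ : Formula.InLang n ψ) :
      Jn n (Formula.imp (Formula.box k (Formula.imp φ ψ))
        (Formula.imp (Formula.box k φ) (Formula.box k ψ)))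
  | lob {k : ℕ} (hk : k < n) (φ : Formula) (hφ : Formula.InLang n φ) :
      Jn n (Formula.imp (Formula.box k (Formula.imp (Formula.box k φ) φ)) (Formula.box k φ))
  | trans1 {k m : ℕ} (hkm : k ≤ m) (hm : m < n) (φ : Formula) (hφ : Formula.InLang n φ) :
      Jn n (Formula.imp (Formula.box k φ) (Formula.box k (Formula.box m φ)))
  | trans2 {k m : ℕ} (hkm : k ≤ m) (hm : m < n) (φ : Formula) (hφ : Formula.InLang n φ) :
      Jn n (Formula.imp (Formula.box k φ) (Formula.box m (Formula.box k φ)))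
  | diaMono {k m : ℕ} (hkm : k < m) (hm : m < n) (φ : Formula) (hφ : Formula.InLang n φ) :
      Jn n (Formula.imp (Formula.dia k φ) (Formula.box m (Formula.dia k φ)))
  | mp {φ ψ : Formula} : Jn n (Formula.imp φ ψ) → Jn n φ → Jn n ψ
  | nec {k : ℕ} (hk : k < n) {φ : Formula} : Jn n φ → Jn n (Formula.box k φ)

/-- The logic `J_n.lin`: `J_n` together with the pseudo-linearity axioms. -/
inductive JnLin (n : ℕ) : Formula → Prop
  | taut {φ : Formula} : Tautology φ → Formula.InLang n φ → JnLin n φ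
  | distr {k : ℕ} (hk : k < n) (φ ψ : Formula)
      (hφ : Formula.InLang n φ) (hψ : Formula.InLang n ψ) :
      JnLin n (Formula.imp (Formula.box k (Formula.imp φ ψ))
        (Formula.imp (Formula.box k φ) (Formula.box k ψ)))
  | lob {k : ℕ} (hk : k < n) (φ : Formula) (hφ : Formula.InLang n φ) :
      JnLin n (Formula.imp (Formula.box k (Formula.imp (Formula.box k φ) φ)) (Formula.box k φ))
  | trans1 {k m : ℕ} (hkm : k ≤ m) (hm : m < n) (φ : Formula) (hφ : Formula.InLang n φ) :
      JnLin n (Formula.imp (Formula.box k φ) (Formula.box k (Formula.box m φ)))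
  | trans2 {k m : ℕ} (hkm : k ≤ m) (hm : m < n) (φ : Formula) (hφ : Formula.InLang n φ) :
      JnLin n (Formula.imp (Formula.box k φ) (Formula.box m (Formula.box k φ)))
  | diaMono {k m : ℕ} (hkm : k < m) (hm : m < n) (φ : Formula) (hφ : Formula.InLang n φ) :
      JnLin n (Formula.imp (Formula.dia k φ) (Formula.box m (Formula.dia k φ)))
  | lin {m : ℕ} (hm : m < n) (φ ψ : Formula)
      (hφ : Formula.InLang n φ) (hψ : Formula.InLang n ψ) :
      JnLin n (psLin n m φ ψ)
  | mp {φ ψ : Formula} : JnLin n (Formula.imp φ ψ) → JnLin n φ → JnLin n ψ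
  | nec {k : ℕ} (hk : k < n) {φ : Formula} : JnLin n φ → JnLin n (Formula.box k φ)

section Frames

variable {T : Type*}

/-- `(T, <_0, …, <_{n-1})` (encoded as `R : ℕ → T → T → Prop`, only the
relations `R i` for `i < n` being relevant) is a `J_n`-frame. -/
def IsJnFrame (n : ℕ) (R : ℕ → T → T → Prop) : Prop :=
  (∀ i < n, Irreflexive (R i)) ∧
  (∀ i < n, Transitive (R i)) ∧
  (∀ i < n, WellFounded fun a b => R i b a) ∧
  ∀ ⦃k m : ℕ⦄, k < m → m < n →
    (∀ ⦃x y z : T⦄, R m x y → R k y z → R k x z) ∧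
    (∀ ⦃x y z : T⦄, R k x y → R m y z → R k x z) ∧
    (∀ ⦃x y z : T⦄, R k x z → R m y z → R k x y)

/-- A frame is hereditarily linear if any two distinct points are comparable
by some relation `<_k`, `k < n`. -/
def HereditarilyLinear (n : ℕ) (R : ℕ → T → T → Prop) : Prop :=
  ∀ x y : T, x ≠ y → ∃ k < n, R k x y ∨ R k y x

/-- A frame is stratified if `x <_m y` and `z <_k y` imply `x <_m z` for `k < m < n`. -/
def Stratified (n : ℕ) (R : ℕ → T → T → Prop) : Prop :=
  ∀ ⦃k m : ℕ⦄, k < m → m < n → ∀ ⦃x y z : T⦄, R m x y → R k z y → R m x z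

/-- The relations `≡_k` (for `k ≤ n`): `≡_n` is identity and `≡_k` is the
equivalence relation generated by the union of `<_k` and `≡_{k+1}`.
Equivalence classes of `≡_k` are the `k`-planes. -/
def eqvRel (R : ℕ → T → T → Prop) (n : ℕ) (k : ℕ) : T → T → Prop :=
  if _ : k < n then
    Relation.EqvGen fun x y => R k x y ∨ eqvRel R n (k + 1) x y
  else Eq
termination_by n - k
decreasing_by omega

/-- Kripke satisfaction in the model `(T, R, V)`. -/
def Sat (R : ℕ → T → T → Prop) (V : ℕ → T → Prop) : T → Formula → Prop
  | w, Formula.var p => V p w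
  | _, Formula.top => True
  | w, Formula.neg a => ¬ Sat R V w a
  | w, Formula.and a b => Sat R V w a ∧ Sat R V w b
  | w, Formula.or a b => Sat R V w a ∨ Sat R V w b
  | w, Formula.imp a b => Sat R V w a → Sat R V w b
  | w, Formula.box m a => ∀ v : T, R m w v → Sat R V v a

end Frames

/-- A set of formulas is consistent with the logic `L` if no finite conjunction
of its elements has its negation provable in `L`. -/
def SetConsistent (L : Formula → Prop) (S : Set Formula) : Prop :=
  ∀ l : List Formula, (∀ φ ∈ l, φ ∈ S) → ¬ L (Formula.neg (bigConj l))

/-- A maximal `L`-consistent set of `L_{[<n]}`-formulas. -/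
def MCS (L : Formula → Prop) (n : ℕ) (S : Set Formula) : Prop :=
  (∀ φ ∈ S, Formula.InLang n φ) ∧ SetConsistent L S ∧
  ∀ S' : Set Formula, (∀ φ ∈ S', Formula.InLang n φ) → S ⊆ S' → S ≠ S' → ¬ SetConsistent L S'

/-- The canonical accessibility relation `x <_m y`. -/
def canonR (m : ℕ) (x y : Set Formula) : Prop :=
  (∀ ψ : Formula, Formula.box m ψ ∈ x → ψ ∈ y) ∧
  (∃ ψ : Formula, Formula.box m ψ ∈ y ∧ Formula.box m ψ ∉ x)

/-- A set of formulas is `k`-maximal if it contains `¬ψ ∧ ⋀_{k≤m<n}[m]ψ` for some `ψ`. -/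
def kMaximal (n k : ℕ) (S : Set Formula) : Prop :=
  ∃ ψ : Formula, Formula.and (Formula.neg ψ) (boxConj k n ψ) ∈ S

theorem RespectsBool.bigConj_eq_true {v : Formula → Bool} (hv : RespectsBool v)
    (l : List Formula) : v (bigConj l) = true ↔ ∀ a ∈ l, v a = true := by
  induction l with
  | nil => simpa [bigConj] using hv.1
  | cons a l ih =>
    have h : bigConj (a :: l) = Formula.and a (bigConj l) := rfl
    simp [h, hv.2.2.1, ih]

theorem Formula.inLang_bigConj {n : ℕ} {l : List Formula} :
    Formula.InLang n (bigConj l) ↔ ∀ a ∈ l, Formula.InLang n a := by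
  induction l with
  | nil => simp [bigConj, Formula.InLang]
  | cons a l ih =>
    have h : bigConj (a :: l) = Formula.and a (bigConj l) := rfl
    simp [h, Formula.InLang, ih]

theorem Formula.inLang_boxConj {n k : ℕ} {φ : Formula} (hφ : Formula.InLang n φ) :
    Formula.InLang n (boxConj k n φ) := by
  refine Formula.inLang_bigConj.2 fun a ha => ?_
  obtain ⟨m, hm, rfl⟩ := List.mem_map.1 ha
  rw [List.mem_range'_1] at hm
  exact ⟨by omega, hφ⟩

namespace MCS

variable {n : ℕ} {S : Set Formula}

/-- If `φ` does not belong to a maximal consistent set, then its negation is provable from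
finitely many elements of the set. -/
theorem exists_refutation (hS : MCS (JnLin n) n S) {φ : Formula} (hφ : Formula.InLang n φ)
    (h : φ ∉ S) : ∃ l : List Formula, (∀ a ∈ l, a ∈ S) ∧
      JnLin n (Formula.imp (bigConj l) (Formula.neg φ)) := by
  have hincons : ¬ SetConsistent (JnLin n) (insert φ S) :=
    hS.2.2 _ (by rintro a (rfl | ha); exacts [hφ, hS.1 a ha]) (Set.subset_insert _ _)
      fun he => h (he ▸ Set.mem_insert _ _)
  simp only [SetConsistent, not_forall, not_not] at hincons
  obtain ⟨l, hl, hprov⟩ := hincons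
  have hsub : ∀ a ∈ l.filter (· ≠ φ), a ∈ S := by
    intro a ha
    simp only [ne_eq, decide_not, List.mem_filter, Bool.not_eq_eq_eq_not, Bool.not_true,
      decide_eq_false_iff_not] at ha
    exact (hl a ha.1).resolve_left ha.2
  have hlang : ∀ a ∈ l, Formula.InLang n a := by
    intro a ha
    rcases hl a ha with rfl | ha
    exacts [hφ, hS.1 a ha]
  refine ⟨_, hsub, .mp (.taut ?_ ?_) hprov⟩
  · intro v hv
    have h₁ := hv.bigConj_eq_true l
    have h₂ := hv.bigConj_eq_true (l.filter (· ≠ φ))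
    rw [hv.2.2.2.2, hv.2.2.2.2, hv.2.1, hv.2.1]
    by_contra hc
    simp only [Bool.not_eq_true, Bool.or_eq_false_iff, Bool.not_eq_false', Bool.not_not] at hc
    have hall : ∀ a ∈ l, v a = true := by
      intro a ha
      by_cases haφ : a = φ
      · exact haφ ▸ hc.2.2
      · exact h₂.1 hc.2.1 a (by simp [ha, haφ])
    simp [h₁.2 hall] at hc
  · exact ⟨Formula.inLang_bigConj.2 hlang,
      Formula.inLang_bigConj.2 fun a ha => hS.1 a (hsub a ha), hφ⟩

/-- Maximal consistent sets are closed under derivability. -/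
theorem mem_of_provable_imp (hS : MCS (JnLin n) n S) {l : List Formula} {φ : Formula}
    (hφ : Formula.InLang n φ) (hl : ∀ a ∈ l, a ∈ S)
    (hprov : JnLin n (Formula.imp (bigConj l) φ)) : φ ∈ S := by
  by_contra h
  obtain ⟨l', hl', hprov'⟩ := hS.exists_refutation hφ h
  have hsub : ∀ a ∈ l ++ l', a ∈ S := by
    intro a ha
    exact (List.mem_append.1 ha).elim (hl a) (hl' a)
  have hlang : ∀ a ∈ l ++ l', Formula.InLang n a := fun a ha => hS.1 a (hsub a ha)
  refine hS.2.1 _ hsub (.mp (.mp (.taut ?_ ?_) hprov) hprov')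
  · intro v hv
    have h₁ := hv.bigConj_eq_true l
    have h₂ := hv.bigConj_eq_true l'
    have h₃ := hv.bigConj_eq_true (l ++ l')
    simp only [List.mem_append, or_imp, forall_and, ← h₁, ← h₂] at h₃
    simp only [hv.2.2.2.2, hv.2.1]
    revert h₃
    cases v (bigConj l) <;> cases v (bigConj l') <;> cases v (bigConj (l ++ l')) <;>
      cases v φ <;> simp
  · simp only [List.mem_append, or_imp, forall_and] at hlang
    refine ⟨⟨Formula.inLang_bigConj.2 hlang.1, hφ⟩,
      ⟨Formula.inLang_bigConj.2 hlang.2, hφ⟩, Formula.inLang_bigConj.2 ?_⟩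
    simpa only [List.mem_append, or_imp, forall_and] using hlang

/-- Maximal consistent sets are closed under tautological consequence. -/
theorem mem_of_entails (hS : MCS (JnLin n) n S) (l : List Formula) {φ : Formula}
    (hφ : Formula.InLang n φ) (hl : ∀ a ∈ l, a ∈ S)
    (h : ∀ v, RespectsBool v → (∀ a ∈ l, v a = true) → v φ = true) : φ ∈ S := by
  refine hS.mem_of_provable_imp hφ hl
    (.taut ?_ ⟨Formula.inLang_bigConj.2 fun a ha => hS.1 a (hl a ha), hφ⟩)
  intro v hv
  have h₁ := hv.bigConj_eq_true l
  rw [hv.2.2.2.2]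
  cases hc : v (bigConj l)
  · rfl
  · simp [h v hv (h₁.1 hc)]

theorem mem_of_provable (hS : MCS (JnLin n) n S) {φ : Formula} (hφ : Formula.InLang n φ)
    (h : JnLin n φ) : φ ∈ S := by
  refine hS.mem_of_provable_imp (l := []) hφ (by simp) (.mp (.taut ?_ ⟨hφ, trivial, hφ⟩) h)
  intro v hv
  simp only [hv.2.2.2.2]
  cases v φ <;> simp

theorem neg_mem (hS : MCS (JnLin n) n S) {φ : Formula} (hφ : Formula.InLang n φ) (h : φ ∉ S) :
    Formula.neg φ ∈ S := by
  obtain ⟨l, hl, hprov⟩ := hS.exists_refutation hφ h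
  exact hS.mem_of_provable_imp hφ hl hprov

theorem not_mem_of_neg_mem (hS : MCS (JnLin n) n S) {φ : Formula} (h : Formula.neg φ ∈ S) :
    φ ∉ S := by
  intro h'
  refine hS.2.1 [φ, Formula.neg φ] (by simp [h, h']) (.taut ?_ ⟨hS.1 _ h', hS.1 _ h, trivial⟩)
  intro v hv
  simp only [bigConj, List.foldr, hv.2.1, hv.2.2.1]
  cases v φ <;> simp

theorem mp_mem (hS : MCS (JnLin n) n S) {φ ψ : Formula} (h : Formula.imp φ ψ ∈ S)
    (hφ : φ ∈ S) : ψ ∈ S := by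
  refine hS.mem_of_entails [Formula.imp φ ψ, φ] (hS.1 _ h).2 (by simp [h, hφ]) ?_
  intro v hv hl
  simp only [List.mem_cons, List.not_mem_nil, or_false, forall_eq_or_imp, forall_eq,
    hv.2.2.2.2] at hl
  simpa [hl.2] using hl.1

theorem or_mem_iff (hS : MCS (JnLin n) n S) {φ ψ : Formula} (hφ : Formula.InLang n φ)
    (hψ : Formula.InLang n ψ) : Formula.or φ ψ ∈ S ↔ φ ∈ S ∨ ψ ∈ S := by
  constructor
  · intro h
    by_contra hc
    rw [not_or] at hc
    refine hc.2 (hS.mem_of_entails [Formula.or φ ψ, Formula.neg φ] hψ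
      (by simp [h, hS.neg_mem hφ hc.1]) ?_)
    intro v hv hl
    simp only [List.mem_cons, List.not_mem_nil, or_false, forall_eq_or_imp, forall_eq,
      hv.2.2.2.1, hv.2.1] at hl
    revert hl
    cases v φ <;> simp
  · rintro (h | h)
    · exact hS.mem_of_entails [φ] ⟨hφ, hψ⟩ (by simp [h]) fun v hv hl => by
        simp [hv.2.2.2.1, hl φ (by simp)]
    · exact hS.mem_of_entails [ψ] ⟨hφ, hψ⟩ (by simp [h]) fun v hv hl => by
        simp [hv.2.2.2.1, hl ψ (by simp)]

theorem and_mem_iff (hS : MCS (JnLin n) n S) {φ ψ : Formula} :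
    Formula.and φ ψ ∈ S ↔ φ ∈ S ∧ ψ ∈ S := by
  constructor
  · intro h
    have hv' : ∀ v, RespectsBool v → (∀ a ∈ [Formula.and φ ψ], v a = true) →
        v φ = true ∧ v ψ = true := fun v hv hl => by simpa [hv.2.2.1] using hl
    exact ⟨hS.mem_of_entails _ (hS.1 _ h).1 (by simpa using h) fun v hv hl => (hv' v hv hl).1,
      hS.mem_of_entails _ (hS.1 _ h).2 (by simpa using h) fun v hv hl => (hv' v hv hl).2⟩
  · rintro ⟨h, h'⟩
    exact hS.mem_of_entails [φ, ψ] ⟨hS.1 _ h, hS.1 _ h'⟩ (by simp [h, h']) fun v hv hl => by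
      simpa [hv.2.2.1] using hl

theorem bigConj_mem_iff (hS : MCS (JnLin n) n S) {l : List Formula} :
    bigConj l ∈ S ↔ ∀ a ∈ l, a ∈ S := by
  induction l with
  | nil =>
    simpa using hS.mem_of_entails [] (φ := bigConj []) trivial (by simp) fun v hv _ => hv.1
  | cons a l ih =>
    have h : bigConj (a :: l) = Formula.and a (bigConj l) := rfl
    simp [h, hS.and_mem_iff, ih]

theorem boxConj_mem_iff (hS : MCS (JnLin n) n S) {k : ℕ} {φ : Formula} :
    boxConj k n φ ∈ S ↔ ∀ m, k ≤ m → m < n → Formula.box m φ ∈ S := by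
  rw [boxConj, hS.bigConj_mem_iff]
  simp only [List.forall_mem_map, List.mem_range'_1]
  exact ⟨fun h m h₁ h₂ => h m ⟨h₁, by omega⟩, fun h m hm => h m hm.1 (by omega)⟩

theorem box_mono (hS : MCS (JnLin n) n S) {m : ℕ} {φ ψ : Formula} (hψ : Formula.InLang n ψ)
    (htaut : Tautology (Formula.imp φ ψ)) (h : Formula.box m φ ∈ S) : Formula.box m ψ ∈ S := by
  obtain ⟨hm, hφ⟩ := hS.1 _ h
  have hprov : JnLin n (Formula.imp (Formula.box m φ) (Formula.box m ψ)) :=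
    .mp (.distr hm φ ψ hφ hψ) (.nec hm (.taut htaut ⟨hφ, hψ⟩))
  have hlang : Formula.InLang n (Formula.imp (Formula.box m φ) (Formula.box m ψ)) :=
    ⟨⟨hm, hφ⟩, hm, hψ⟩
  exact hS.mp_mem (hS.mem_of_provable hlang hprov) h

end MCS

/-- For a `k`-maximal target set, the second condition defining `<_m` follows from the first
when `k ≤ m < n`. -/
theorem canonR_of_kMaximal {n k m : ℕ} (hkm : k ≤ m) (hm : m < n) {x y : Set Formula}
    (hy : MCS (JnLin n) n y) (hym : kMaximal n k y)
    (h : ∀ ψ, Formula.box m ψ ∈ x → ψ ∈ y) : canonR m x y := by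
  obtain ⟨χ, hχ⟩ := hym
  rw [hy.and_mem_iff] at hχ
  exact ⟨h, χ, hy.boxConj_mem_iff.1 hχ.2 m hkm hm,
    fun hx => hy.not_mem_of_neg_mem hχ.1 (h χ hx)⟩

/-- If `x <_m y` fails for all `k ≤ m < n` and `y` is `k`-maximal, then a single formula
witnesses all these failures. -/
theorem exists_boxConj_mem_of_not_canonR {n k : ℕ} {x y : Set Formula}
    (hx : MCS (JnLin n) n x) (hy : MCS (JnLin n) n y) (hym : kMaximal n k y)
    (h : ¬ ∃ m, k ≤ m ∧ m < n ∧ canonR m x y) :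
    ∃ φ, Formula.InLang n φ ∧ φ ∉ y ∧ boxConj k n φ ∈ x := by
  suffices H : ∀ N ≤ n, ∃ φ, Formula.InLang n φ ∧ φ ∉ y ∧
      ∀ m, k ≤ m → m < N → Formula.box m φ ∈ x by
    obtain ⟨φ, hφ, hφy, hbox⟩ := H n le_rfl
    exact ⟨φ, hφ, hφy, hx.boxConj_mem_iff.2 hbox⟩
  intro N
  induction N with
  | zero =>
    refine fun _ => ⟨Formula.neg Formula.top, trivial, fun hc => ?_, fun m _ hm => by omega⟩
    exact hy.not_mem_of_neg_mem hc
      (hy.mem_of_entails [] (φ := Formula.top) trivial (by simp) fun v hv _ => hv.1)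
  | succ N ih =>
    intro hN
    obtain ⟨φ, hφ, hφy, hbox⟩ := ih (by omega)
    by_cases hkN : k ≤ N
    · have hfail : ¬ ∀ ψ, Formula.box N ψ ∈ x → ψ ∈ y := fun hc =>
        h ⟨N, hkN, hN, canonR_of_kMaximal hkN hN hy hym hc⟩
      push Not at hfail
      obtain ⟨ψ, hψx, hψy⟩ := hfail
      have hψ : Formula.InLang n ψ := (hx.1 _ hψx).2
      refine ⟨Formula.or φ ψ, ⟨hφ, hψ⟩, ?_, fun m hkm hm => ?_⟩
      · rw [hy.or_mem_iff hφ hψ]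
        tauto
      · rcases Nat.lt_succ_iff_lt_or_eq.1 hm with hm | rfl
        · refine hx.box_mono ⟨hφ, hψ⟩ (fun v hv => ?_) (hbox m hkm hm)
          rw [hv.2.2.2.2, hv.2.2.2.1]
          cases v φ <;> simp
        · refine hx.box_mono ⟨hφ, hψ⟩ (fun v hv => ?_) hψx
          rw [hv.2.2.2.2, hv.2.2.2.1]
          cases v ψ <;> simp
    · exact ⟨φ, hφ, hφy, fun m hkm hm => by omega⟩

/-- If `z <_k x`, `z <_k y` in the canonical model of `J_n.lin` and both `x`
and `y` are `k`-maximal, then `x = y`, or `x <_m y` for some `k ≤ m < n`, or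
`y <_m x` for some `k ≤ m < n`. -/
theorem k_maximal_comparable (n k : ℕ) (hk : k < n) (x y z : Set Formula)
    (hx : MCS (JnLin n) n x) (hy : MCS (JnLin n) n y) (hz : MCS (JnLin n) n z)
    (hzx : canonR k z x) (hzy : canonR k z y)
    (hxm : kMaximal n k x) (hym : kMaximal n k y) :
    x = y ∨ (∃ m, k ≤ m ∧ m < n ∧ canonR m x y) ∨ (∃ m, k ≤ m ∧ m < n ∧ canonR m y x) := by
  by_contra hc
  simp only [not_or] at hc
  obtain ⟨hne, hxy, hyx⟩ := hc
  obtain ⟨φ, hφ, hφy, hφx⟩ := exists_boxConj_mem_of_not_canonR hx hy hym hxy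
  obtain ⟨ψ, hψ, hψx, hψy⟩ := exists_boxConj_mem_of_not_canonR hy hx hxm hyx
  have hsep : ∃ θ, Formula.InLang n θ ∧ θ ∉ x ∧ θ ∈ y := by
    by_contra hc
    push Not at hc
    exact hy.2.2 x hx.1 (fun a ha => by_contra fun h => hc a (hy.1 a ha) h ha) (Ne.symm hne) hx.2.1
  obtain ⟨θ, hθ, hθx, hθy⟩ := hsep
  have hB : Formula.InLang n (Formula.or ψ θ) := ⟨hψ, hθ⟩
  have hBx : Formula.or ψ θ ∉ x := by
    rw [hx.or_mem_iff hψ hθ]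
    tauto
  have hBy : Formula.or ψ θ ∈ y := (hy.or_mem_iff hψ hθ).2 (.inr hθy)
  have hBoxBy : boxConj k n (Formula.or ψ θ) ∈ y := by
    refine hy.boxConj_mem_iff.2 fun m hkm hm => hy.box_mono hB (fun v hv => ?_)
      (hy.boxConj_mem_iff.1 hψy m hkm hm)
    rw [hv.2.2.2.2, hv.2.2.2.1]
    cases v ψ <;> simp
  have hl₁ : Formula.InLang n
      (Formula.box k (Formula.imp (boxConj k n φ) (Formula.or ψ θ))) :=
    ⟨hk, Formula.inLang_boxConj hφ, hB⟩
  have hl₂ : Formula.InLang n (Formula.box k (Formula.imp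
      (Formula.and (boxConj k n (Formula.or ψ θ)) (Formula.or ψ θ)) φ)) :=
    ⟨hk, ⟨Formula.inLang_boxConj hB, hB⟩, hφ⟩
  have hlin : psLin n k φ (Formula.or ψ θ) ∈ z :=
    hz.mem_of_provable ⟨hl₁, hl₂⟩ (.lin hk φ _ hφ hB)
  rcases (hz.or_mem_iff hl₁ hl₂).1 hlin with h | h
  · exact hBx (hx.mp_mem (hzx.1 _ h) hφx)
  · exact hφy (hy.mp_mem (hzy.1 _ h) (hy.and_mem_iff.2 ⟨hBoxBy, hBy⟩))
end

section
/- Let n ≥ 1 and let φ be a closed L_{[<n]}-formula consistent with GLP. Then there is k ∈ ℕ such that GLP proves ⟨n-1⟩^k ⊤ → ⟨0⟩φ, where ⟨n-1⟩^k denotes the k-fold iteration of ⟨n-1⟩. -/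
/-- The laws of the `GLP` diamonds, as a family of operators on a Boolean algebra. -/
structure GLPDiamonds {B : Type*} [BooleanAlgebra B] (d : ℕ → B → B) : Prop where
  mono (m : ℕ) : Monotone (d m)
  map_sup_le (m : ℕ) (a b : B) : d m (a ⊔ b) ≤ d m a ⊔ d m b
  map_bot (m : ℕ) : d m ⊥ = ⊥
  lob (m : ℕ) (a : B) : d m a ≤ d m (a ⊓ (d m a)ᶜ)
  succ_le (m : ℕ) (a : B) : d (m + 1) a ≤ d m a
  persist (m : ℕ) (a : B) : d m a ≤ (d (m + 1) (d m a)ᶜ)ᶜ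

namespace GLPDiamonds

variable {B : Type*} [BooleanAlgebra B] {d : ℕ → B → B}

theorem map_sup (h : GLPDiamonds d) (m : ℕ) (a b : B) : d m (a ⊔ b) = d m a ⊔ d m b :=
  le_antisymm (h.map_sup_le m a b) (sup_le (h.mono m le_sup_left) (h.mono m le_sup_right))

theorem trans (h : GLPDiamonds d) (m : ℕ) (a : B) : d m (d m a) ≤ d m a := by
  have hb : (a ⊔ d m a) ⊓ (d m (a ⊔ d m a))ᶜ ≤ a := by
    have h1 : d m a ≤ d m (a ⊔ d m a) := h.mono m le_sup_left
    rw [inf_sup_right]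
    refine sup_le inf_le_left ?_
    rw [(le_compl_iff_disjoint_right.1 (by rwa [compl_compl])).eq_bot]
    exact bot_le
  exact (h.mono m le_sup_right).trans ((h.lob m _).trans (h.mono m hb))

theorem eq_bot_of_le (h : GLPDiamonds d) {m : ℕ} {a : B} (ha : a ≤ d m a) : a = ⊥ := by
  have h1 : a ⊓ (d m a)ᶜ = ⊥ := (le_compl_iff_disjoint_right.1 (by rwa [compl_compl])).eq_bot
  have h2 := h.lob m a
  rw [h1, h.map_bot] at h2
  exact le_bot_iff.1 (ha.trans h2)

theorem antitone_index (h : GLPDiamonds d) (a : B) : Antitone fun m => d m a :=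
  antitone_nat_of_succ_le fun m => h.succ_le m a

theorem disjoint_map_compl (h : GLPDiamonds d) {m k : ℕ} (hmk : m < k) (a : B) :
    Disjoint (d m a) (d k (d m a)ᶜ) :=
  le_compl_iff_disjoint_right.1 <|
    (h.persist m a).trans (compl_le_compl (h.antitone_index _ hmk))

theorem map_inf_map (h : GLPDiamonds d) {m k : ℕ} (hmk : m < k) (s a : B) :
    d k (s ⊓ d m a) = d k s ⊓ d m a := by
  refine le_antisymm (le_inf (h.mono k inf_le_left) ?_) ?_
  · exact (h.mono k inf_le_right).trans ((h.antitone_index _ hmk.le).trans (h.trans m a))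
  · calc d k s ⊓ d m a ≤ d k (s ⊓ d m a ⊔ (d m a)ᶜ) ⊓ d m a := by
          refine inf_le_inf_right _ (h.mono k ?_)
          rw [sup_inf_right, sup_compl_eq_top, inf_top_eq]
          exact le_sup_left
      _ ≤ d k (s ⊓ d m a) := by
          rw [h.map_sup, inf_sup_right, (h.disjoint_map_compl hmk a).symm.eq_bot, sup_bot_eq]
          exact inf_le_left

theorem map_sdiff_map (h : GLPDiamonds d) {m k : ℕ} (hmk : m < k) (s a : B) :
    d k (s \ d m a) = d k s \ d m a := by
  refine le_antisymm ?_ ?_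
  · rw [_root_.sdiff_eq, _root_.sdiff_eq]
    exact le_inf (h.mono k inf_le_left) ((h.mono k inf_le_right).trans
      (le_compl_iff_disjoint_right.2 (h.disjoint_map_compl hmk a).symm))
  · rw [sdiff_le_iff]
    calc d k s ≤ d k (s ⊓ d m a ⊔ s \ d m a) := h.mono k (by rw [sup_inf_sdiff])
      _ ≤ d m a ⊔ d k (s \ d m a) := by
        rw [h.map_sup, h.map_inf_map hmk]
        exact sup_le_sup_right inf_le_right _

end GLPDiamonds

/-- Iterated differences `a \ b₁ \ ⋯ \ bₖ` of elements of `S`. -/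
inductive IterDiff {B : Type*} [BooleanAlgebra B] (S : Set B) : B → Prop
  | base {a : B} : a ∈ S → IterDiff S a
  | step {x b : B} : IterDiff S x → b ∈ S → IterDiff S (x \ b)

/-- Every element of the Boolean closure of an inf-closed set is a finite join
of iterated differences. -/
theorem BooleanSubalgebra.closure_induction_iterDiff {B : Type*} [BooleanAlgebra B] {S : Set B}
    (hS : InfClosed S) (htop : ⊤ ∈ S) {P : B → Prop} (hdiff : ∀ x, IterDiff S x → P x)
    (hsup : ∀ x y, P x → P y → P (x ⊔ y)) {x : B} (hx : x ∈ BooleanSubalgebra.closure S) :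
    P x := by
  have hbot : P ⊥ := by
    have := hdiff _ ((IterDiff.base htop).step htop)
    rwa [sdiff_self] at this
  have hS' : InfClosed (insert ⊥ S) := by
    rintro a (rfl | ha) b (rfl | hb)
    · simp
    · simp
    · simp
    · exact Or.inr (hS ha hb)
  have hle : BooleanSubalgebra.closure S ≤ BooleanSubalgebra.closure (supClosure (insert ⊥ S)) :=
    BooleanSubalgebra.closure_mono ((Set.subset_insert _ _).trans subset_supClosure)
  have hright : ∀ y ∈ supClosure (insert ⊥ S), ∀ x, IterDiff S x → IterDiff S (x \ y) := by
    intro y hy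
    refine supClosure_min (t := {y | ∀ x, IterDiff S x → IterDiff S (x \ y)}) ?_ ?_ hy
    · rintro y (rfl | hy) x hx
      · rwa [sdiff_bot]
      · exact hx.step hy
    · intro y hy z hz x hx
      rw [← sdiff_sdiff_left]
      exact hz _ (hy _ hx)
  have hleft : ∀ x ∈ supClosure (insert ⊥ S), ∀ y ∈ supClosure (insert ⊥ S), P (x \ y) := by
    intro x hx
    refine supClosure_min
      (t := {x | ∀ y ∈ supClosure (insert ⊥ S), P (x \ y)}) ?_ ?_ hx
    · rintro x (rfl | hx) y hy
      · rwa [bot_sdiff]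
      · exact hdiff _ (hright y hy _ (.base hx))
    · intro x hx z hz y hy
      rw [sup_sdiff]
      exact hsup _ _ (hx y hy) (hz y hy)
  exact BooleanSubalgebra.closure_sdiff_sup_induction (p := fun x _ => P x)
    (s := supClosure (insert ⊥ S))
    ⟨supClosed_supClosure, hS'.supClosure⟩ (subset_supClosure (Set.mem_insert _ _))
    (subset_supClosure (Or.inr htop)) (fun x hx y hy => hleft x hx y hy)
    (fun x _ y _ hx hy => hsup x y hx hy) x (hle hx)

/-- The worms obtained from `S` (worms with letters above `m`) by adjoining the letter `m`,
where `f` is the diamond of `m`. -/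
inductive WormExt {B : Type*} [BooleanAlgebra B] (f : B → B) (S : Set B) : B → Prop
  | base {a : B} : a ∈ S → WormExt f S a
  | step {a b : B} : a ∈ S → WormExt f S b → WormExt f S (a ⊓ f b)

/-- `S` behaves like the set of worms with letters in `[m, n)`. -/
structure IsWormSet {B : Type*} [BooleanAlgebra B] (d : ℕ → B → B) (n m : ℕ) (S : Set B) :
    Prop where
  top_mem : ⊤ ∈ S
  infClosed : InfClosed S
  trichotomy : ∀ a ∈ S, ∀ b ∈ S, a ≤ d m b ∨ b ≤ d m a ∨ a = b
  iterate_le : ∀ a ∈ S, ∃ k : ℕ, (d (n - 1))^[k] ⊤ ≤ a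
  map_mem_closure : ∀ k, m ≤ k → k < n → ∀ x ∈ BooleanSubalgebra.closure S,
    d k x ∈ BooleanSubalgebra.closure S

section Worms

variable {B : Type*} [BooleanAlgebra B] {d : ℕ → B → B}

theorem WormExt.trichotomy (h : GLPDiamonds d) {m : ℕ} {S : Set B}
    (hS : ∀ a ∈ S, ∀ b ∈ S, a ≤ d (m + 1) b ∨ b ≤ d (m + 1) a ∨ a = b) {a : B}
    (ha : WormExt (d m) S a) :
    ∀ {b : B}, WormExt (d m) S b → a ≤ d m b ∨ b ≤ d m a ∨ a = b := by
  have key : ∀ {a₁ b₁ q b : B}, b₁ ≤ d (m + 1) a₁ → b ≤ b₁ → b ≤ d m q →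
      b ≤ d m (a₁ ⊓ d m q) := by
    intro a₁ b₁ q b h1 h2 h3
    refine le_trans ?_ (h.succ_le m _)
    rw [h.map_inf_map (Nat.lt_succ_self m)]
    exact le_inf (h2.trans h1) h3
  have chain : ∀ {a b c : B}, a ≤ d m b ∨ a = b → c ≤ d m a → c ≤ d m b := by
    rintro a b c (h1 | rfl) h2
    · exact h2.trans ((h.mono m h1).trans (h.trans m b))
    · exact h2
  induction ha with
  | @base a ha =>
    intro b hb
    induction hb with
    | @base b hb =>
      rcases hS a ha b hb with h1 | h1 | h1
      · exact Or.inl (h1.trans (h.succ_le m b))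
      · exact Or.inr (Or.inl (h1.trans (h.succ_le m a)))
      · exact Or.inr (Or.inr h1)
    | @step b₁ b₂ hb₁ hb₂ ih =>
      have hle : a ≤ d m b₂ → a ≤ d m (b₁ ⊓ d m b₂) ∨ b₁ ⊓ d m b₂ ≤ d m a ∨ a = b₁ ⊓ d m b₂ := by
        intro h2
        rcases hS a ha b₁ hb₁ with h1 | h1 | rfl
        · exact Or.inl (key h1 le_rfl h2)
        · exact Or.inr (Or.inl (inf_le_left.trans (h1.trans (h.succ_le m a))))
        · exact Or.inr (Or.inr (inf_eq_left.2 h2).symm)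
      rcases ih with h2 | h2 | h2
      · exact hle h2
      · exact Or.inr (Or.inl (chain (Or.inl h2) inf_le_right))
      · exact Or.inr (Or.inl (chain (Or.inr h2.symm) inf_le_right))
  | @step a₁ a₂ ha₁ ha₂ iha =>
    intro b hb
    induction hb with
    | @base b hb =>
      rcases iha (.base hb) with h2 | h2 | h2
      · exact Or.inl (chain (Or.inl h2) inf_le_right)
      · rcases hS a₁ ha₁ b hb with h1 | h1 | rfl
        · exact Or.inl (inf_le_left.trans (h1.trans (h.succ_le m b)))
        · exact Or.inr (Or.inl (key h1 le_rfl h2))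
        · exact Or.inr (Or.inr (inf_eq_left.2 h2))
      · exact Or.inl (chain (Or.inr h2) inf_le_right)
    | @step b₁ b₂ hb₁ hb₂ ih =>
      rcases iha (.step hb₁ hb₂) with h2 | h2 | h2
      · exact Or.inl (chain (Or.inl h2) inf_le_right)
      · rcases ih with h3 | h3 | h3
        · rcases hS a₁ ha₁ b₁ hb₁ with h1 | h1 | rfl
          · exact Or.inl (key h1 inf_le_left h3)
          · exact Or.inr (Or.inl (key h1 inf_le_left h2))
          · exact Or.inr (Or.inr (le_antisymm (le_inf inf_le_left h3) (le_inf inf_le_left h2)))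
        · exact Or.inr (Or.inl (chain (Or.inl h3) inf_le_right))
        · exact Or.inr (Or.inl (chain (Or.inr h3.symm) inf_le_right))
      · exact Or.inl (chain (Or.inr h2) inf_le_right)

theorem WormExt.inf (h : GLPDiamonds d) {m : ℕ} {S : Set B} (hinf : InfClosed S)
    (hS : ∀ a ∈ S, ∀ b ∈ S, a ≤ d (m + 1) b ∨ b ≤ d (m + 1) a ∨ a = b) {a b : B}
    (ha : WormExt (d m) S a) (hb : WormExt (d m) S b) : WormExt (d m) S (a ⊓ b) := by
  cases ha with
  | base ha =>
    cases hb with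
    | base hb => exact .base (hinf ha hb)
    | step hb₁ hb₂ => rw [← inf_assoc]; exact .step (hinf ha hb₁) hb₂
  | @step a₁ a₂ ha₁ ha₂ =>
    cases hb with
    | base hb => rw [inf_right_comm]; exact .step (hinf ha₁ hb) ha₂
    | @step b₁ b₂ hb₁ hb₂ =>
      rw [inf_inf_inf_comm]
      rcases ha₂.trichotomy h hS hb₂ with h1 | h1 | rfl
      · rw [inf_eq_left.2 ((h.mono m h1).trans (h.trans m _))]
        exact .step (hinf ha₁ hb₁) ha₂
      · rw [inf_eq_right.2 ((h.mono m h1).trans (h.trans m _))]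
        exact .step (hinf ha₁ hb₁) hb₂
      · rw [inf_idem]
        exact .step (hinf ha₁ hb₁) ha₂

/-- An iterated difference with leading term `a` contains all the `m`-maximal part of `a`,
unless it is empty. -/
theorem IterDiff.exists_le (h : GLPDiamonds d) {m : ℕ} {S : Set B} (hinf : InfClosed S)
    (hS : ∀ a ∈ S, ∀ b ∈ S, a ≤ d m b ∨ b ≤ d m a ∨ a = b) {x : B} (hx : IterDiff S x) :
    ∃ a ∈ S, x ≤ a ∧ (x = ⊥ ∨ a ⊓ (d m a)ᶜ ≤ x) := by
  induction hx with
  | @base a ha => exact ⟨a, ha, le_rfl, Or.inr inf_le_left⟩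
  | @step x b _ hb ih =>
    obtain ⟨a, ha, hxa, rfl | hax⟩ := ih
    · exact ⟨a, ha, by simp, Or.inl (by simp)⟩
    refine ⟨a, ha, sdiff_le.trans hxa, ?_⟩
    rcases hS a ha _ (hinf ha hb) with h1 | h1 | h1
    · have ha0 := h.eq_bot_of_le (h1.trans (h.mono m inf_le_left))
      exact Or.inl (le_bot_iff.1 (sdiff_le.trans (hxa.trans ha0.le)))
    · refine Or.inr (le_sdiff.2 ⟨hax, ?_⟩)
      rw [disjoint_iff_inf_le, inf_right_comm]
      exact (inf_le_inf_right _ h1).trans (inf_compl_self _).le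
    · exact Or.inl (sdiff_eq_bot_iff.2 (hxa.trans (inf_eq_left.1 h1.symm)))

theorem IterDiff.map_eq (h : GLPDiamonds d) {m : ℕ} {S : Set B} (hinf : InfClosed S)
    (hS : ∀ a ∈ S, ∀ b ∈ S, a ≤ d m b ∨ b ≤ d m a ∨ a = b) {x : B} (hx : IterDiff S x) :
    x = ⊥ ∨ ∃ a ∈ S, d m x = d m a := by
  obtain ⟨a, ha, hxa, h0 | hax⟩ := hx.exists_le h hinf hS
  · exact Or.inl h0
  · exact Or.inr ⟨a, ha, le_antisymm (h.mono m hxa) ((h.lob m a).trans (h.mono m hax))⟩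

theorem WormExt.exists_eq_inf (h : GLPDiamonds d) {m k : ℕ} (hmk : m < k) {S : Set B}
    (htop : ⊤ ∈ S) {x : B} (hx : WormExt (d m) S x) :
    ∃ a ∈ S, ∃ q, WormExt (d m) S q ∧ x = a ⊓ q ∧ (∀ s, d k (s ⊓ q) = d k s ⊓ q) ∧
      ∀ s, d k (s \ q) = d k s \ q := by
  cases hx with
  | base hx => exact ⟨x, hx, ⊤, .base htop, by simp, by simp, by simp [h.map_bot]⟩
  | @step a b ha hb =>
    refine ⟨a, ha, d m b, ?_, rfl, (h.map_inf_map hmk · b), (h.map_sdiff_map hmk · b)⟩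
    simpa using WormExt.step htop hb

theorem IterDiff.map_inf_mem_closure (h : GLPDiamonds d) {m k : ℕ} (hmk : m < k) {S : Set B}
    (htop : ⊤ ∈ S)
    (hcl : ∀ x ∈ BooleanSubalgebra.closure S, d k x ∈ BooleanSubalgebra.closure S)
    {x : B} (hx : IterDiff {y | WormExt (d m) S y} x) :
    ∀ s ∈ BooleanSubalgebra.closure S,
      d k (s ⊓ x) ∈ BooleanSubalgebra.closure {y | WormExt (d m) S y} := by
  have hle : BooleanSubalgebra.closure S ≤ BooleanSubalgebra.closure {y | WormExt (d m) S y} :=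
    BooleanSubalgebra.closure_mono fun a ha => WormExt.base ha
  induction hx with
  | @base x hx =>
    intro s hs
    obtain ⟨a, ha, q, hq, rfl, h1, -⟩ := WormExt.exists_eq_inf h hmk htop hx
    rw [← inf_assoc, h1]
    exact BooleanSubalgebra.inf_mem
      (hle (hcl _ (BooleanSubalgebra.inf_mem hs (BooleanSubalgebra.subset_closure ha))))
      (BooleanSubalgebra.subset_closure hq)
  | @step x b _ hb ih =>
    intro s hs
    obtain ⟨a, ha, q, hq, rfl, -, h2⟩ := WormExt.exists_eq_inf h hmk htop hb
    have ha' := BooleanSubalgebra.subset_closure ha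
    have hx : s ⊓ x \ (a ⊓ q) = s \ a ⊓ x ⊔ (s ⊓ x) \ q := by
      simp only [_root_.sdiff_eq, compl_inf, inf_sup_left]
      congr 1
      · rw [← inf_assoc, inf_right_comm]
      · rw [inf_assoc]
    rw [hx, h.map_sup, h2]
    exact BooleanSubalgebra.sup_mem (ih _ (BooleanSubalgebra.sdiff_mem hs ha'))
      (BooleanSubalgebra.sdiff_mem (ih _ hs) (BooleanSubalgebra.subset_closure hq))

theorem iterate_top_antitone (h : GLPDiamonds d) (m : ℕ) : Antitone fun k => (d m)^[k] ⊤ :=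
  (h.mono m).antitone_iterate_of_map_le le_top

theorem WormExt.iterate_le (h : GLPDiamonds d) {n m : ℕ} (hm : m < n) {S : Set B}
    (hS : ∀ a ∈ S, ∃ k : ℕ, (d (n - 1))^[k] ⊤ ≤ a) {a : B} (ha : WormExt (d m) S a) :
    ∃ k : ℕ, (d (n - 1))^[k] ⊤ ≤ a := by
  induction ha with
  | base ha => exact hS _ ha
  | @step a b ha _ ih =>
    obtain ⟨k, hk⟩ := hS a ha
    obtain ⟨l, hl⟩ := ih
    refine ⟨max k (l + 1), le_inf ?_ ?_⟩
    · exact (iterate_top_antitone h _ (le_max_left _ _)).trans hk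
    · refine (iterate_top_antitone h _ (le_max_right _ _)).trans ?_
      dsimp only
      rw [Function.iterate_succ_apply']
      exact (h.mono _ hl).trans (h.antitone_index b (by omega : m ≤ n - 1))

theorem IsWormSet.ext (h : GLPDiamonds d) {n m : ℕ} (hm : m < n) {S : Set B}
    (hS : IsWormSet d n (m + 1) S) : IsWormSet d n m {x | WormExt (d m) S x} := by
  have htop : ⊤ ∈ {x | WormExt (d m) S x} := WormExt.base hS.top_mem
  have hinf : InfClosed {x | WormExt (d m) S x} :=
    fun a ha b hb => WormExt.inf h hS.infClosed hS.trichotomy ha hb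
  have htri : ∀ a ∈ {x | WormExt (d m) S x}, ∀ b ∈ {x | WormExt (d m) S x},
      a ≤ d m b ∨ b ≤ d m a ∨ a = b :=
    fun a ha b hb => WormExt.trichotomy h hS.trichotomy ha hb
  refine ⟨htop, hinf, htri, fun a ha => WormExt.iterate_le h hm hS.iterate_le ha, ?_⟩
  intro k hmk hkn x hx
  refine BooleanSubalgebra.closure_induction_iterDiff hinf htop
    (P := fun x => d k x ∈ BooleanSubalgebra.closure {x | WormExt (d m) S x}) ?_ ?_ hx
  · intro x hx
    rcases hmk.eq_or_lt with rfl | hlt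
    · rcases hx.map_eq h hinf htri with rfl | ⟨a, ha, hxa⟩
      · rw [h.map_bot]
        exact BooleanSubalgebra.bot_mem
      · rw [hxa]
        refine BooleanSubalgebra.subset_closure ?_
        simpa using WormExt.step hS.top_mem ha
    · simpa using hx.map_inf_mem_closure h hlt hS.top_mem (hS.map_mem_closure k hlt hkn) ⊤
        BooleanSubalgebra.top_mem
  · intro x y hx hy
    rw [h.map_sup]
    exact BooleanSubalgebra.sup_mem hx hy

theorem exists_isWormSet (h : GLPDiamonds d) (n : ℕ) {m : ℕ} (hm : m ≤ n) :
    ∃ S : Set B, IsWormSet d n m S := by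
  induction hm using Nat.decreasingInduction with
  | self =>
    exact ⟨{⊤}, rfl, infClosed_singleton, fun a ha b hb => Or.inr (Or.inr (ha.trans hb.symm)),
      fun a ha => ⟨0, ha.ge⟩, fun k h1 h2 => absurd h2 h1.not_gt⟩
  | of_succ m hm ih =>
    obtain ⟨S, hS⟩ := ih
    exact ⟨_, hS.ext h hm⟩

theorem IsWormSet.exists_iterate_le (h : GLPDiamonds d) {n : ℕ} {S : Set B}
    (hS : IsWormSet d n 0 S) {x : B} (hx : x ∈ BooleanSubalgebra.closure S) (h0 : x ≠ ⊥) :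
    ∃ k : ℕ, (d (n - 1))^[k] ⊤ ≤ d 0 x := by
  refine BooleanSubalgebra.closure_induction_iterDiff hS.infClosed hS.top_mem
    (P := fun x => x ≠ ⊥ → ∃ k : ℕ, (d (n - 1))^[k] ⊤ ≤ d 0 x) ?_ ?_ hx h0
  · intro x hx h0
    obtain ⟨a, ha, hxa⟩ := (hx.map_eq h hS.infClosed hS.trichotomy).resolve_left h0
    obtain ⟨k, hk⟩ := hS.iterate_le a ha
    refine ⟨k + 1, ?_⟩
    rw [Function.iterate_succ_apply', hxa]
    exact (h.mono _ hk).trans (h.antitone_index a (Nat.zero_le _))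
  · intro x y hx hy h0
    by_cases hx0 : x = ⊥
    · subst hx0
      rw [bot_sup_eq] at h0 ⊢
      exact hy h0
    · obtain ⟨k, hk⟩ := hx hx0
      exact ⟨k, hk.trans (h.mono 0 le_sup_left)⟩

end Worms

namespace GLP

open Formula

theorem imp_refl (a : Formula) : GLP (imp a a) :=
  taut fun v ⟨_, _, _, _, hi⟩ => by rw [hi]; cases v a <;> rfl

theorem imp_trans {a b c : Formula} (h1 : GLP (imp a b)) (h2 : GLP (imp b c)) : GLP (imp a c) :=
  mp (mp (taut (φ := imp (imp a b) (imp (imp b c) (imp a c))) fun v ⟨_, _, _, _, hi⟩ => by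
    simp only [hi]; cases v a <;> cases v b <;> cases v c <;> rfl) h1) h2

theorem imp_and {a b c : Formula} (h1 : GLP (imp a b)) (h2 : GLP (imp a c)) :
    GLP (imp a (and b c)) :=
  mp (mp (taut (φ := imp (imp a b) (imp (imp a c) (imp a (and b c)))) fun v ⟨_, _, ha, _, hi⟩ => by
    simp only [hi, ha]; cases v a <;> cases v b <;> cases v c <;> rfl) h1) h2

theorem or_imp {a b c : Formula} (h1 : GLP (imp a c)) (h2 : GLP (imp b c)) :
    GLP (imp (or a b) c) :=
  mp (mp (taut (φ := imp (imp a c) (imp (imp b c) (imp (or a b) c))) fun v ⟨_, _, _, ho, hi⟩ => by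
    simp only [hi, ho]; cases v a <;> cases v b <;> cases v c <;> rfl) h1) h2

theorem and_imp_left (a b : Formula) : GLP (imp (and a b) a) :=
  taut fun v ⟨_, _, ha, _, hi⟩ => by simp only [hi, ha]; cases v a <;> cases v b <;> rfl

theorem and_imp_right (a b : Formula) : GLP (imp (and a b) b) :=
  taut fun v ⟨_, _, ha, _, hi⟩ => by simp only [hi, ha]; cases v a <;> cases v b <;> rfl

theorem imp_or_left (a b : Formula) : GLP (imp a (or a b)) :=
  taut fun v ⟨_, _, _, ho, hi⟩ => by simp only [hi, ho]; cases v a <;> cases v b <;> rfl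

theorem imp_or_right (a b : Formula) : GLP (imp b (or a b)) :=
  taut fun v ⟨_, _, _, ho, hi⟩ => by simp only [hi, ho]; cases v a <;> cases v b <;> rfl

theorem contrapose {a b : Formula} (h : GLP (imp a b)) : GLP (imp (neg b) (neg a)) :=
  mp (taut (φ := imp (imp a b) (imp (neg b) (neg a))) fun v ⟨_, hn, _, _, hi⟩ => by
    simp only [hi, hn]; cases v a <;> cases v b <;> rfl) h

theorem imp_neg_neg (a : Formula) : GLP (imp a (neg (neg a))) :=
  taut fun v ⟨_, hn, _, _, hi⟩ => by simp only [hi, hn]; cases v a <;> rfl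

theorem box_imp (m : ℕ) {a b : Formula} (h : GLP (imp a b)) : GLP (imp (box m a) (box m b)) :=
  mp (distr m a b) (nec m h)

theorem dia_imp (m : ℕ) {a b : Formula} (h : GLP (imp a b)) : GLP (imp (dia m a) (dia m b)) :=
  contrapose (box_imp m (contrapose h))

theorem dia_or (m : ℕ) (a b : Formula) : GLP (imp (dia m (or a b)) (or (dia m a) (dia m b))) := by
  have h1 : GLP (imp (neg a) (imp (neg b) (neg (or a b)))) :=
    taut fun v ⟨_, hn, _, ho, hi⟩ => by simp only [hi, hn, ho]; cases v a <;> cases v b <;> rfl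
  have h2 := imp_trans (box_imp m h1) (distr m _ _)
  refine mp (taut (φ := imp (imp (box m (neg a)) (imp (box m (neg b)) (box m (neg (or a b))))) _)
    fun v ⟨_, hn, _, ho, hi⟩ => ?_) h2
  simp only [dia, hi, hn, ho]
  cases v (box m (neg a)) <;> cases v (box m (neg b)) <;> cases v (box m (neg (or a b))) <;> rfl

theorem dia_bot (m : ℕ) : GLP (imp (dia m (neg top)) (neg top)) := by
  have h1 : GLP (box m (neg (neg top))) :=
    nec m (taut fun v ⟨ht, hn, _, _, _⟩ => by simp [hn, ht])
  exact mp (taut (φ := imp (box m (neg (neg top))) _) fun v ⟨_, hn, _, _, hi⟩ => by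
    simp only [dia, hi, hn]; cases v (box m (neg (neg top))) <;> simp) h1

theorem dia_lob (m : ℕ) (a : Formula) : GLP (imp (dia m a) (dia m (and a (neg (dia m a))))) := by
  have h1 : GLP (imp (neg (and a (neg (dia m a)))) (imp (box m (neg a)) (neg a))) :=
    taut fun v ⟨_, hn, ha, _, hi⟩ => by
      simp only [dia, hi, hn, ha]; cases v a <;> cases v (box m (neg a)) <;> rfl
  exact contrapose (imp_trans (box_imp m h1) (lob m _))

theorem dia_succ (m : ℕ) (a : Formula) : GLP (imp (dia (m + 1) a) (dia m a)) :=
  contrapose (mono m _)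

theorem dia_persist (m : ℕ) (a : Formula) :
    GLP (imp (dia m a) (neg (dia (m + 1) (neg (dia m a))))) :=
  imp_trans (diaMono m a) (imp_trans (box_imp (m + 1) (imp_neg_neg _)) (imp_neg_neg _))

/-- Provable implication. -/
instance : Preorder Formula where
  le a b := GLP (imp a b)
  le_refl := imp_refl
  le_trans _ _ _ := imp_trans

/-- The Lindenbaum algebra of `GLP`. -/
abbrev Lindenbaum : Type := Antisymmetrization Formula (· ≤ ·)

/-- The class of a formula in the Lindenbaum algebra. -/
def mk (a : Formula) : Lindenbaum := toAntisymmetrization (· ≤ ·) a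

theorem mk_le_mk {a b : Formula} : mk a ≤ mk b ↔ GLP (imp a b) := Iff.rfl

/-- Conjunction of classes. -/
def Lindenbaum.and : Lindenbaum → Lindenbaum → Lindenbaum :=
  Quotient.map₂ Formula.and fun _ _ h _ _ h' =>
    ⟨imp_and (imp_trans (and_imp_left _ _) h.1) (imp_trans (and_imp_right _ _) h'.1),
      imp_and (imp_trans (and_imp_left _ _) h.2) (imp_trans (and_imp_right _ _) h'.2)⟩

/-- Disjunction of classes. -/
def Lindenbaum.or : Lindenbaum → Lindenbaum → Lindenbaum :=
  Quotient.map₂ Formula.or fun _ _ h _ _ h' =>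
    ⟨or_imp (imp_trans h.1 (imp_or_left _ _)) (imp_trans h'.1 (imp_or_right _ _)),
      or_imp (imp_trans h.2 (imp_or_left _ _)) (imp_trans h'.2 (imp_or_right _ _))⟩

/-- Negation of classes. -/
def Lindenbaum.neg : Lindenbaum → Lindenbaum :=
  Quotient.map Formula.neg fun _ _ h => ⟨contrapose h.2, contrapose h.1⟩

/-- The operator `⟨m⟩` on classes. -/
def Lindenbaum.dia (m : ℕ) : Lindenbaum → Lindenbaum :=
  Quotient.map (Formula.dia m) fun _ _ h => ⟨dia_imp m h.1, dia_imp m h.2⟩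

instance : Lattice Lindenbaum where
  inf := Lindenbaum.and
  sup := Lindenbaum.or
  inf_le_left := by rintro ⟨a⟩ ⟨b⟩; exact and_imp_left a b
  inf_le_right := by rintro ⟨a⟩ ⟨b⟩; exact and_imp_right a b
  le_inf := by rintro ⟨a⟩ ⟨b⟩ ⟨c⟩ h1 h2; exact imp_and (mk_le_mk.1 h1) (mk_le_mk.1 h2)
  le_sup_left := by rintro ⟨a⟩ ⟨b⟩; exact imp_or_left a b
  le_sup_right := by rintro ⟨a⟩ ⟨b⟩; exact imp_or_right a b
  sup_le := by rintro ⟨a⟩ ⟨b⟩ ⟨c⟩ h1 h2; exact or_imp (mk_le_mk.1 h1) (mk_le_mk.1 h2)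

instance : BooleanAlgebra Lindenbaum where
  le_sup_inf := by
    rintro ⟨a⟩ ⟨b⟩ ⟨c⟩
    exact taut (φ := imp (Formula.and (Formula.or a b) (Formula.or a c))
      (Formula.or a (Formula.and b c))) fun v ⟨_, _, ha, ho, hi⟩ => by
        simp only [ha, ho, hi]; cases v a <;> cases v b <;> cases v c <;> rfl
  compl := Lindenbaum.neg
  top := mk top
  bot := mk (neg top)
  inf_compl_le_bot := by
    rintro ⟨a⟩
    exact taut (φ := imp (Formula.and a (neg a)) (neg top)) fun v ⟨_, hn, ha, _, hi⟩ => by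
      simp only [ha, hn, hi]; cases v a <;> simp
  top_le_sup_compl := by
    rintro ⟨a⟩
    exact taut (φ := imp top (Formula.or a (neg a))) fun v ⟨_, hn, _, ho, hi⟩ => by
      simp only [hn, ho, hi]; cases v a <;> simp
  le_top := by
    rintro ⟨a⟩
    exact taut (φ := imp a top) fun v ⟨ht, _, _, _, hi⟩ => by simp [ht, hi]
  bot_le := by
    rintro ⟨a⟩
    exact taut (φ := imp (neg top) a) fun v ⟨ht, hn, _, _, hi⟩ => by simp [ht, hn, hi]

theorem mk_top : mk top = ⊤ := rfl

theorem mk_dia (m : ℕ) (a : Formula) : mk (dia m a) = Lindenbaum.dia m (mk a) := rfl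

theorem mk_imp (a b : Formula) : mk (imp a b) = (mk a)ᶜ ⊔ mk b :=
  le_antisymm
    (taut (φ := imp (imp a b) (or (neg a) b)) fun v ⟨_, hn, _, ho, hi⟩ => by
      simp only [hn, ho, hi]; cases v a <;> cases v b <;> rfl)
    (taut (φ := imp (or (neg a) b) (imp a b)) fun v ⟨_, hn, _, ho, hi⟩ => by
      simp only [hn, ho, hi]; cases v a <;> cases v b <;> rfl)

theorem mk_box (m : ℕ) (a : Formula) : mk (box m a) = (Lindenbaum.dia m (mk a)ᶜ)ᶜ := by
  have h1 : GLP (imp (neg (neg a)) a) := taut fun v ⟨_, hn, _, _, hi⟩ => by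
    simp only [hi, hn]; cases v a <;> rfl
  have h2 : (Lindenbaum.dia m (mk a)ᶜ)ᶜ = (mk (box m (neg (neg a))))ᶜᶜ := rfl
  rw [h2, compl_compl]
  exact le_antisymm (box_imp m (imp_neg_neg a)) (box_imp m h1)

theorem mk_eq_bot {a : Formula} : mk a = ⊥ ↔ GLP (neg a) := by
  rw [← le_bot_iff]
  refine ⟨fun h => mp (taut (φ := imp (imp a (neg top)) (neg a)) fun v ⟨ht, hn, _, _, hi⟩ => by
    simp only [hi, hn, ht]; cases v a <;> rfl) h, fun h => ?_⟩
  exact mp (taut (φ := imp (neg a) (imp a (neg top))) fun v ⟨ht, hn, _, _, hi⟩ => by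
    simp only [hi, hn, ht]; cases v a <;> rfl) h

theorem glpDiamonds_dia : GLPDiamonds Lindenbaum.dia where
  mono m := by rintro ⟨a⟩ ⟨b⟩ h; exact dia_imp m (mk_le_mk.1 h)
  map_sup_le m := by rintro ⟨a⟩ ⟨b⟩; exact dia_or m a b
  map_bot m := le_bot_iff.1 (dia_bot m)
  lob m := by rintro ⟨a⟩; exact dia_lob m a
  succ_le m := by rintro ⟨a⟩; exact dia_succ m a
  persist m := by rintro ⟨a⟩; exact dia_persist m a

theorem mk_mem_closure {n : ℕ} {S : Set Lindenbaum} (hS : IsWormSet Lindenbaum.dia n 0 S)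
    {φ : Formula} (hφ : InLang n φ) (hc : Closed φ) : mk φ ∈ BooleanSubalgebra.closure S := by
  induction φ with
  | var => exact hc.elim
  | top => exact BooleanSubalgebra.top_mem
  | neg a ih => exact BooleanSubalgebra.compl_mem (ih hφ hc)
  | and a b iha ihb => exact BooleanSubalgebra.inf_mem (iha hφ.1 hc.1) (ihb hφ.2 hc.2)
  | or a b iha ihb => exact BooleanSubalgebra.sup_mem (iha hφ.1 hc.1) (ihb hφ.2 hc.2)
  | imp a b iha ihb =>
    rw [mk_imp]
    exact BooleanSubalgebra.sup_mem (BooleanSubalgebra.compl_mem (iha hφ.1 hc.1))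
      (ihb hφ.2 hc.2)
  | box m a ih =>
    rw [mk_box]
    exact BooleanSubalgebra.compl_mem (hS.map_mem_closure m (Nat.zero_le m) hφ.1 _
      (BooleanSubalgebra.compl_mem (ih hφ.2 hc)))

theorem mk_iterate_dia (m k : ℕ) (a : Formula) :
    mk ((fun ψ => dia m ψ)^[k] a) = (Lindenbaum.dia m)^[k] (mk a) :=
  (Function.Semiconj.iterate_right (f := mk) (fun ψ => mk_dia m ψ) k) a

end GLP

/-- If `n ≥ 1` and `φ` is a closed `L_{[<n]}`-formula consistent with `GLP`,
then there is `k ∈ ℕ` such that `GLP ⊢ ⟨n-1⟩^k ⊤ → ⟨0⟩φ`. -/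
theorem closed_consistent_reachable (n : ℕ) (hn : 1 ≤ n) (φ : Formula)
    (hφ : Formula.InLang n φ) (hclosed : Formula.Closed φ)
    (hcons : ¬ GLP (Formula.neg φ)) :
    ∃ k : ℕ,
      GLP (Formula.imp ((fun ψ => Formula.dia (n - 1) ψ)^[k] Formula.top)
        (Formula.dia 0 φ)) := by
  obtain ⟨S, hS⟩ := exists_isWormSet GLP.glpDiamonds_dia n (Nat.zero_le n)
  obtain ⟨k, hk⟩ := hS.exists_iterate_le GLP.glpDiamonds_dia
    (GLP.mk_mem_closure hS hφ hclosed) (mt GLP.mk_eq_bot.1 hcons)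
  refine ⟨k, GLP.mk_le_mk.1 ?_⟩
  rwa [GLP.mk_iterate_dia, GLP.mk_dia, GLP.mk_top]
end

section
/- Let (T, <_0, …, <_{n-1}) be a finite hereditarily linear J_n-frame with a hereditary root r (i.e., every world of T other than r is reachable from r by a finite composition of the relations <_0, …, <_{n-1}), and let a valuation on T be given. If the formula φ ∧ M⁺(φ) holds at r, then there exists a closed substitution φ* of φ that is consistent with GLP. -/
/-- The list of boxed subformulas `[m]ψ` of a formula, as pairs `(m, ψ)`. -/
def boxedSubs : Formula → List (ℕ × Formula)
  | Formula.var _ => []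
  | Formula.top => []
  | Formula.neg a => boxedSubs a
  | Formula.and a b => boxedSubs a ++ boxedSubs b
  | Formula.or a b => boxedSubs a ++ boxedSubs b
  | Formula.imp a b => boxedSubs a ++ boxedSubs b
  | Formula.box m a => (m, a) :: boxedSubs a

/-- `M(φ) = ⋀ { ⋀_{k=m+1}^{n-1} ([m]ψ → [k]ψ) : [m]ψ a subformula of φ }`. -/
def Mform (n : ℕ) (φ : Formula) : Formula :=
  bigConj ((boxedSubs φ).map fun p =>
    bigConj ((List.range' (p.1 + 1) (n - (p.1 + 1))).map fun k =>
      Formula.imp (Formula.box p.1 p.2) (Formula.box k p.2)))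

/-- `M⁺(φ) = M(φ) ∧ ⋀_{m<n} [m] M(φ)`. -/
def Mplus (n : ℕ) (φ : Formula) : Formula :=
  Formula.and (Mform n φ)
    (bigConj ((List.range n).map fun m => Formula.box m (Mform n φ)))

namespace OrdinalModel

open Filter Topology Set

/-- The Cantor–Bendixson rank of an ordinal in the order topology (the last exponent of its
Cantor normal form). -/
noncomputable def rank (α : Ordinal.{0}) : Ordinal.{0} :=
  sInf {γ | ∀ᶠ ξ in 𝓝[<] α, ∀ _ : ξ < α, rank ξ ≠ γ}
termination_by α

theorem rank_eq (α : Ordinal.{0}) : rank α = sInf {γ | ∀ᶠ ξ in 𝓝[<] α, rank ξ ≠ γ} := by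
  rw [rank]
  congr 1
  ext γ
  rw [mem_ofPred_eq, mem_ofPred_eq]
  refine eventually_congr ?_
  filter_upwards [self_mem_nhdsWithin] with ξ hξ
  exact ⟨fun h => h hξ, fun h _ => h⟩

theorem rank_le_self (α : Ordinal.{0}) : rank α ≤ α := by
  induction α using WellFoundedLT.induction with
  | ind α ih =>
    rw [rank_eq]
    refine csInf_le' ?_
    filter_upwards [self_mem_nhdsWithin] with ξ hξ
    exact ((ih ξ hξ).trans_lt hξ).ne

theorem frequently_rank_eq {α γ : Ordinal.{0}} (h : γ < rank α) :
    ∃ᶠ ξ in 𝓝[<] α, rank ξ = γ := by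
  rw [rank_eq] at h
  have hmem := notMem_of_lt_csInf' h
  exact hmem

theorem le_rank {α γ : Ordinal.{0}} (h : ∀ δ < γ, ∃ᶠ ξ in 𝓝[<] α, rank ξ = δ) :
    γ ≤ rank α := by
  rw [rank_eq]
  refine le_csInf ⟨α, ?_⟩ fun δ hδ => ?_
  · filter_upwards [self_mem_nhdsWithin] with ξ hξ
    exact ((rank_le_self ξ).trans_lt hξ).ne
  · by_contra! hlt
    exact h δ hlt hδ

theorem mem_nhdsLT_of_lt {α δ : Ordinal.{0}} (h : δ < α) {s : Set Ordinal.{0}} :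
    s ∈ 𝓝[<] α ↔ ∃ η < α, Ioo η α ⊆ s :=
  mem_nhdsLT_iff_exists_Ioo_subset' h

theorem exists_rank_eq (γ δ : Ordinal.{0}) : ∃ α, δ < α ∧ rank α = γ := by
  induction γ using WellFoundedLT.induction generalizing δ with
  | ind γ ih =>
    suffices h : ∃ α, δ < α ∧ γ ≤ rank α by
      obtain ⟨α, hα, hγ⟩ := h
      rcases hγ.eq_or_lt with hγ | hγ
      · exact ⟨α, hα, hγ.symm⟩
      · have := (frequently_rank_eq hγ).and_eventually
          ((mem_nhdsLT_of_lt hα).2 ⟨δ, hα, Subset.rfl⟩)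
        obtain ⟨ξ, hξ, hmem⟩ := this.exists
        exact ⟨ξ, hmem.1, hξ⟩
    choose next hlt hrank using fun (ζ : Iio γ) (δ : Ordinal.{0}) => ih ζ.1 ζ.2 δ
    let f : Ordinal.{0} → Ordinal.{0} := fun x =>
      max (Order.succ x) (⨆ ζ : Iio γ, next ζ x)
    have hf : ∀ x, x < f x := fun x => (Order.lt_succ x).trans_le (le_max_left _ _)
    have hnext : ∀ (ζ : Iio γ) (x : Ordinal.{0}), next ζ x ≤ f x := fun ζ x =>
      (Ordinal.le_iSup (fun ζ : Iio γ => next ζ x) ζ).trans (le_max_right _ _)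
    have hlt_nfp : ∀ k, f^[k] δ < Ordinal.nfp f δ := fun k => by
      refine lt_of_lt_of_le ?_ (Ordinal.iterate_le_nfp f δ (k + 1))
      rw [Function.iterate_succ_apply']
      exact hf _
    refine ⟨Ordinal.nfp f δ, hlt_nfp 0, le_rank fun ζ hζ => ?_⟩
    intro hev
    obtain ⟨η, hη, hsub⟩ := (mem_nhdsLT_of_lt (hlt_nfp 0)).1 hev
    obtain ⟨k, hk⟩ := Ordinal.lt_nfp_iff.1 hη
    refine hsub ⟨hk.trans (hlt ⟨ζ, hζ⟩ _), ?_⟩ (hrank ⟨ζ, hζ⟩ (f^[k] δ))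
    refine (hnext ⟨ζ, hζ⟩ _).trans_lt ?_
    have := hlt_nfp (k + 1)
    rwa [Function.iterate_succ_apply'] at this

/-- The filter of punctured neighbourhoods of an ordinal in the `m`-th Icard topology. -/
noncomputable def nbhd : ℕ → Ordinal.{0} → Filter Ordinal.{0}
  | 0, α => 𝓟 (Iio α)
  | m + 1, α => comap rank (nbhd m (rank α)) ⊓ 𝓝[<] α

theorem nbhd_le_Iio (m : ℕ) (α : Ordinal.{0}) : nbhd m α ≤ 𝓟 (Iio α) := by
  cases m with
  | zero => exact le_rfl
  | succ m => exact inf_le_right.trans inf_le_right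

theorem nbhd_succ_le (m : ℕ) (α : Ordinal.{0}) : nbhd (m + 1) α ≤ nbhd m α := by
  induction m generalizing α with
  | zero => exact nbhd_le_Iio 1 α
  | succ m ih => exact inf_le_inf_right _ (comap_mono (ih _))

theorem nbhd_antitone (α : Ordinal.{0}) : Antitone fun m => nbhd m α :=
  antitone_nat_of_succ_le fun m => nbhd_succ_le m α

theorem eventually_nhdsLT_nhdsLT {α : Ordinal.{0}} {p : Ordinal.{0} → Prop}
    (h : ∀ᶠ ξ in 𝓝[<] α, p ξ) : ∀ᶠ ξ in 𝓝[≤] α, ∀ᶠ η in 𝓝[<] ξ, p η := by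
  rcases eq_bot_or_bot_lt α with rfl | hα
  · filter_upwards [self_mem_nhdsWithin] with ξ hξ
    obtain rfl : ξ = ⊥ := le_bot_iff.1 hξ
    exact h
  · obtain ⟨δ, hδ, hsub⟩ := (mem_nhdsLT_of_lt hα).1 h
    filter_upwards [Ioc_mem_nhdsLE hδ] with ξ hξ
    exact (mem_nhdsLT_of_lt hξ.1).2 ⟨δ, hξ.1, fun η hη => hsub ⟨hη.1, hη.2.trans_le hξ.2⟩⟩

theorem nhdsLT_le_nhdsLE (α : Ordinal.{0}) : 𝓝[<] α ≤ 𝓝[≤] α :=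
  nhdsWithin_mono _ Iio_subset_Iic_self

theorem eventually_nbhd_trans {m : ℕ} {α : Ordinal.{0}} {p : Ordinal.{0} → Prop}
    (h : ∀ᶠ β in nbhd m α, p β) : ∀ᶠ β in nbhd m α, ∀ᶠ ξ in nbhd m β, p ξ := by
  induction m generalizing α p with
  | zero => exact fun β hβ ξ hξ => h (mem_Iio.2 (lt_trans hξ hβ))
  | succ m ih =>
    obtain ⟨s, hs, t, ht, hst⟩ := mem_inf_iff_superset.1 h
    obtain ⟨u, hu, hus⟩ := mem_comap.1 hs
    refine mem_inf_iff_superset.2 ⟨_, preimage_mem_comap (ih hu), _,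
      nhdsLT_le_nhdsLE α (eventually_nhdsLT_nhdsLT ht), fun ξ hξ => ?_⟩
    exact mem_inf_iff_superset.2 ⟨_, preimage_mem_comap hξ.1, _, hξ.2,
      fun η hη => hst ⟨hus hη.1, hη.2⟩⟩

theorem eventually_nbhd_nbhd {k m : ℕ} (hkm : k ≤ m) {α : Ordinal.{0}}
    {p : Ordinal.{0} → Prop} (h : ∀ᶠ β in nbhd k α, p β) :
    ∀ᶠ β in nbhd m α, ∀ᶠ ξ in nbhd k β, p ξ :=
  nbhd_antitone α hkm (eventually_nbhd_trans h)

theorem eventually_nbhd_lob {m : ℕ} {α : Ordinal.{0}} {p : Ordinal.{0} → Prop}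
    (h : ∀ᶠ β in nbhd m α, (∀ᶠ ξ in nbhd m β, p ξ) → p β) : ∀ᶠ β in nbhd m α, p β := by
  induction α using WellFoundedLT.induction with
  | ind α ih =>
    filter_upwards [h, eventually_nbhd_trans h, nbhd_le_Iio m α (mem_principal_self _)]
      with β hβ hβ' hlt
    exact hβ (ih β hlt hβ')

theorem map_rank_nbhd_succ (m : ℕ) (α : Ordinal.{0}) :
    map rank (nbhd (m + 1) α) = nbhd m (rank α) := by
  rw [nbhd, inf_comm, Filter.push_pull, inf_eq_right]
  refine (nbhd_le_Iio m _).trans fun s hs γ hγ => ?_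
  obtain ⟨ξ, hξ, hs⟩ := ((frequently_rank_eq hγ).and_eventually (mem_map.1 hs)).exists
  exact hξ ▸ hs

theorem eventually_nbhd_succ_rank {m : ℕ} {α : Ordinal.{0}} {p : Ordinal.{0} → Prop} :
    (∀ᶠ ξ in nbhd (m + 1) α, p (rank ξ)) ↔ ∀ᶠ γ in nbhd m (rank α), p γ := by
  rw [← map_rank_nbhd_succ]
  rfl

theorem exists_nbhd_neBot (m : ℕ) : ∃ α, (nbhd m α).NeBot := by
  induction m with
  | zero => exact ⟨1, principal_neBot_iff.2 ⟨0, mem_Iio.2 zero_lt_one⟩⟩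
  | succ m ih =>
    obtain ⟨β, hβ⟩ := ih
    obtain ⟨α, -, rfl⟩ := exists_rank_eq β 0
    rw [← map_rank_nbhd_succ, map_neBot_iff] at hβ
    exact ⟨α, hβ⟩

theorem nbhd_succ_le_nhdsLT (m : ℕ) (α : Ordinal.{0}) : nbhd (m + 1) α ≤ 𝓝[<] α :=
  inf_le_right

/-- Truth of a formula at an ordinal, with every variable interpreted by the empty set. -/
def Holds : Formula → Ordinal.{0} → Prop
  | .var _ => fun _ => False
  | .top => fun _ => True
  | .neg a => fun α => ¬ Holds a α
  | .and a b => fun α => Holds a α ∧ Holds b α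
  | .or a b => fun α => Holds a α ∨ Holds b α
  | .imp a b => fun α => Holds a α → Holds b α
  | .box m a => fun α => ∀ᶠ β in nbhd m α, Holds a β

theorem exists_local_formula (φ : Formula) (α : Ordinal.{0}) :
    ∃ ψ, ∀ᶠ ξ in 𝓝[≤] α, (Holds φ ξ ↔ Holds ψ (rank ξ)) := by
  induction φ with
  | var i => exact ⟨.var i, Eventually.of_forall fun _ => Iff.rfl⟩
  | top => exact ⟨.top, Eventually.of_forall fun _ => Iff.rfl⟩
  | neg a iha =>
    obtain ⟨a', ha⟩ := iha
    exact ⟨.neg a', ha.mono fun ξ h => not_congr h⟩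
  | and a b iha ihb =>
    obtain ⟨a', ha⟩ := iha
    obtain ⟨b', hb⟩ := ihb
    exact ⟨.and a' b', (ha.and hb).mono fun ξ h => and_congr h.1 h.2⟩
  | or a b iha ihb =>
    obtain ⟨a', ha⟩ := iha
    obtain ⟨b', hb⟩ := ihb
    exact ⟨.or a' b', (ha.and hb).mono fun ξ h => or_congr h.1 h.2⟩
  | imp a b iha ihb =>
    obtain ⟨a', ha⟩ := iha
    obtain ⟨b', hb⟩ := ihb
    exact ⟨.imp a' b', (ha.and hb).mono fun ξ h => imp_congr h.1 h.2⟩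
  | box m a iha =>
    cases m with
    | zero =>
      by_cases h : ∀ β < α, Holds a β
      · refine ⟨.top, ?_⟩
        filter_upwards [self_mem_nhdsWithin] with ξ hξ
        exact iff_of_true (fun β hβ => h β (lt_of_lt_of_le hβ hξ)) trivial
      · push Not at h
        obtain ⟨β, hβ, hnot⟩ := h
        refine ⟨.neg .top, ?_⟩
        filter_upwards [Ioc_mem_nhdsLE hβ] with ξ hξ
        exact iff_of_false (fun h => hnot (h hξ.1)) (not_not_intro trivial)
    | succ m =>
      obtain ⟨a', ha⟩ := iha
      refine ⟨.box m a', ?_⟩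
      filter_upwards [eventually_nhdsLT_nhdsLT (nhdsLT_le_nhdsLE α ha)] with ξ hξ
      exact (eventually_congr (nbhd_succ_le_nhdsLT m ξ hξ)).trans eventually_nbhd_succ_rank

theorem eventually_holds_dia_succ {m : ℕ} {φ : Formula} {α : Ordinal.{0}}
    (h : Holds (.dia m φ) α) : ∀ᶠ β in nbhd (m + 1) α, Holds (.dia m φ) β := by
  induction m generalizing φ α with
  | zero =>
    obtain ⟨β, hβ, hφ⟩ := frequently_principal.1 h
    refine nbhd_succ_le_nhdsLT 0 α ((mem_nhdsLT_of_lt hβ).2 ⟨β, hβ, fun ξ hξ => ?_⟩)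
    exact frequently_principal.2 ⟨β, hξ.1, hφ⟩
  | succ m ih =>
    obtain ⟨ψ, hψ⟩ := exists_local_formula φ α
    have key : ∀ᶠ ξ in 𝓝[≤] α, (Holds (.dia (m + 1) φ) ξ ↔ Holds (.dia m ψ) (rank ξ)) := by
      filter_upwards [eventually_nhdsLT_nhdsLT (nhdsLT_le_nhdsLE α hψ)] with ξ hξ
      exact not_congr ((eventually_congr (Eventually.mono (nbhd_succ_le_nhdsLT m ξ hξ)
        fun η hη => not_congr hη)).trans (eventually_nbhd_succ_rank (p := fun γ => ¬ Holds ψ γ)))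
    have hα := (key.self_of_nhdsWithin self_mem_Iic).1 h
    have hle : nbhd (m + 1 + 1) α ≤ 𝓝[≤] α :=
      (nbhd_succ_le_nhdsLT (m + 1) α).trans (nhdsLT_le_nhdsLE α)
    filter_upwards [hle key, eventually_nbhd_succ_rank.2 (ih hα)] with ξ h₁ h₂
    exact h₁.2 h₂

theorem eventually_holds_dia {k m : ℕ} (hkm : k < m) {φ : Formula} {α : Ordinal.{0}}
    (h : Holds (.dia k φ) α) : ∀ᶠ β in nbhd m α, Holds (.dia k φ) β :=
  nbhd_antitone α hkm (eventually_holds_dia_succ h)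

open Classical in
theorem holds_of_GLP {φ : Formula} (h : GLP φ) (α : Ordinal.{0}) : Holds φ α := by
  induction h generalizing α with
  | taut h =>
    refine of_decide_eq_true (h (fun φ => decide (Holds φ α)) ?_)
    refine ⟨decide_eq_true trivial, ?_, ?_, ?_, ?_⟩ <;> intros <;>
      refine Bool.eq_iff_iff.2 (decide_eq_true_iff.trans ?_) <;> simp [Holds, imp_iff_not_or]
  | distr m φ ψ => exact fun h₁ h₂ => Eventually.mp h₂ h₁
  | lob m φ => exact fun h => eventually_nbhd_lob h
  | mono m φ => exact fun h => nbhd_succ_le m α h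
  | diaMono m φ => exact fun h => eventually_holds_dia_succ h
  | mp _ _ ih₁ ih₂ => exact ih₁ α (ih₂ α)
  | nec m _ ih => exact Eventually.of_forall ih

end OrdinalModel

namespace OrdinalModel

open Filter

theorem frequently_nbhd_of_nbhd {k m : ℕ} (hkm : k ≤ m) {α : Ordinal.{0}}
    {p : Ordinal.{0} → Prop} (h : ∃ᶠ β in nbhd m α, ∃ᶠ ξ in nbhd k β, p ξ) :
    ∃ᶠ ξ in nbhd k α, p ξ := fun hev =>
  h ((eventually_nbhd_nbhd hkm hev).mono fun _ hβ => not_not_intro hβ)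

theorem frequently_nbhd_lob {m : ℕ} {α : Ordinal.{0}} {p : Ordinal.{0} → Prop}
    (h : ∃ᶠ β in nbhd m α, p β) :
    ∃ᶠ β in nbhd m α, p β ∧ ¬ ∃ᶠ ξ in nbhd m β, p ξ := fun hev =>
  h (eventually_nbhd_lob (hev.mono fun _ hβ hξ hp => hβ ⟨hp, not_not_intro hξ⟩))

end OrdinalModel

section GradedOrder

variable {T : Type*} {E : ℕ → T → T → Prop}

/-- A linear order whose pairs `x < y` carry a grade, the grade of a composition being the
minimum of the grades: the shape of a hereditarily linear `J_n`-frame. -/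
structure GradedOrder (E : ℕ → T → T → Prop) : Prop where
  irrefl : ∀ {k x}, ¬ E k x x
  comp : ∀ {k m x y z}, E k x y → E m y z → E (min k m) x z
  uniq : ∀ {k m x y}, E k x y → E m x y → k = m
  total : ∀ {x y}, x ≠ y → ∃ k, E k x y ∨ E k y x

theorem IsJnFrame.gradedOrder {n : ℕ} (hJ : IsJnFrame n E) (hHL : HereditarilyLinear n E) :
    GradedOrder fun k x y => k < n ∧ E k x y := by
  obtain ⟨hirr, htrans, -, hmix⟩ := hJ
  have huniq : ∀ {k m x y}, k < m → m < n → E k x y → ¬ E m x y := fun hkm hm h₁ h₂ =>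
    hirr _ (hkm.trans hm) _ ((hmix hkm hm).2.2 h₁ h₂)
  refine ⟨fun h => hirr _ h.1 _ h.2, ?_, ?_, ?_⟩
  · rintro k m x y z ⟨hk, h₁⟩ ⟨hm, h₂⟩
    rcases lt_trichotomy k m with h | rfl | h
    · rw [min_eq_left h.le]
      exact ⟨hk, (hmix h hm).2.1 h₁ h₂⟩
    · rw [min_self]
      exact ⟨hk, htrans _ hk h₁ h₂⟩
    · rw [min_eq_right h.le]
      exact ⟨hm, (hmix h hk).1 h₁ h₂⟩
  · rintro k m x y ⟨hk, h₁⟩ ⟨hm, h₂⟩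
    rcases lt_trichotomy k m with h | h | h
    · exact (huniq h hm h₁ h₂).elim
    · exact h
    · exact (huniq h hk h₂ h₁).elim
  · intro x y hxy
    obtain ⟨k, hk, h⟩ := hHL x y hxy
    exact ⟨k, h.imp (⟨hk, ·⟩) (⟨hk, ·⟩)⟩

namespace GradedOrder

theorem asymm (hE : GradedOrder E) {k m : ℕ} {x y : T} (h₁ : E k x y) : ¬ E m y x :=
  fun h₂ => hE.irrefl (hE.comp h₁ h₂)

theorem wellFounded_lt [Finite T] (hE : GradedOrder E) :
    WellFounded fun x y => ∃ k, E k x y := by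
  have : IsTrans T fun x y => ∃ k, E k x y := ⟨fun _ _ _ ⟨_, h₁⟩ ⟨_, h₂⟩ => ⟨_, hE.comp h₁ h₂⟩⟩
  have : Std.Irrefl fun x y : T => ∃ k, E k x y := ⟨fun _ ⟨_, h⟩ => hE.irrefl h⟩
  exact Finite.wellFounded_of_trans_of_irrefl _

theorem wellFounded_gt [Finite T] (hE : GradedOrder E) :
    WellFounded fun x y => ∃ k, E k y x := by
  have : IsTrans T fun x y => ∃ k, E k y x := ⟨fun _ _ _ ⟨_, h₁⟩ ⟨_, h₂⟩ => ⟨_, hE.comp h₂ h₁⟩⟩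
  have : Std.Irrefl fun x y : T => ∃ k, E k y x := ⟨fun _ ⟨_, h⟩ => hE.irrefl h⟩
  exact Finite.wellFounded_of_trans_of_irrefl _

theorem exists_plane_top [Finite T] (hE : GradedOrder E) (k : ℕ) (x : T) :
    ∃ q, (q = x ∨ ∃ m, k ≤ m ∧ E m x q) ∧ ∀ s m, E m q s → m < k := by
  obtain ⟨q, hq, hmax⟩ := hE.wellFounded_gt.has_min {q | q = x ∨ ∃ m, k ≤ m ∧ E m x q}
    ⟨x, Or.inl rfl⟩
  refine ⟨q, hq, fun s m hs => ?_⟩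
  by_contra! hkm
  refine hmax s (Or.inr ?_) ⟨m, hs⟩
  rcases hq with rfl | ⟨l, hkl, hl⟩
  · exact ⟨m, hkm, hs⟩
  · exact ⟨_, le_min hkl hkm, hE.comp hl hs⟩

theorem exists_pred [Finite T] (hE : GradedOrder E) {x s : T} {k : ℕ} (h : E k s x) :
    ∃ p e, E e p x ∧ ∀ t m, E m p t → t = x ∨ ∃ d, E d x t := by
  obtain ⟨p, ⟨e, he⟩, hmax⟩ := hE.wellFounded_gt.has_min {q | ∃ m, E m q x} ⟨s, k, h⟩
  refine ⟨p, e, he, fun t m ht => or_iff_not_imp_left.2 fun htx => ?_⟩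
  obtain ⟨d, hd | hd⟩ := hE.total htx
  · exact (hmax t ⟨d, hd⟩ ⟨m, ht⟩).elim
  · exact ⟨d, hd⟩

end GradedOrder

open Filter OrdinalModel

/-- The formulas `A t` state that, for each successor `s` of `t`, the formula `A s` is possible
at the grade of `s` over `t`. -/
def IsWormFamily (E : ℕ → T → T → Prop) (A : T → Formula) : Prop :=
  ∀ t α, Holds (A t) α ↔ ∀ k s, E k t s → ∃ᶠ β in nbhd k α, Holds (A s) β

/-- `t` is the first point whose formula `A t` holds at `α`. -/
def IsFirst (E : ℕ → T → T → Prop) (A : T → Formula) (t : T) (α : Ordinal.{0}) : Prop :=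
  Holds (A t) α ∧ ∀ s k, E k s t → ¬ Holds (A s) α

/-- The points `j` that an ordinal assigned to `i` may see through modality `m`. -/
def Visible (E : ℕ → T → T → Prop) (m : ℕ) (i j : T) : Prop :=
  (∃ d, m ≤ d ∧ E d i j) ∨ (j = i ∨ ∃ d, m < d ∧ E d j i) ∧ ∃ s d, m < d ∧ E d s j

namespace IsWormFamily

variable {A : T → Formula} {i j r : T} {m : ℕ} {α : Ordinal.{0}}

theorem frequently (hA : IsWormFamily E A) {k : ℕ} {t s : T} (h : Holds (A t) α)
    (hts : E k t s) : ∃ᶠ β in nbhd k α, Holds (A s) β :=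
  (hA t α).1 h k s hts

theorem exists_isFirst [Finite T] [Nonempty T] (hE : GradedOrder E) (hA : IsWormFamily E A)
    (α : Ordinal.{0}) : ∃ t, IsFirst E A t α := by
  obtain ⟨x⟩ := ‹Nonempty T›
  obtain ⟨q, -, hq⟩ := hE.exists_plane_top 0 x
  have hAq : Holds (A q) α := (hA q α).2 fun k s h => absurd (hq s k h) (Nat.not_lt_zero k)
  obtain ⟨t, ht, hmin⟩ := hE.wellFounded_lt.has_min {t | Holds (A t) α} ⟨q, hAq⟩
  exact ⟨t, ht, fun s k hs h => hmin s h ⟨k, hs⟩⟩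

theorem holds_plane_top (hE : GradedOrder E) (hA : IsWormFamily E A) {k : ℕ} {x q : T}
    (hxq : q = x ∨ ∃ m, k ≤ m ∧ E m x q) (hq : ∀ s m, E m q s → m < k) (h : Holds (A x) α) :
    Holds (A q) α := by
  rcases hxq with rfl | ⟨l, hkl, hl⟩
  · exact h
  · refine (hA q α).2 fun m s hs => hA.frequently h ?_
    have := hE.comp hl hs
    rwa [min_eq_right ((hq s m hs).le.trans hkl)] at this

theorem eventually_not_of_grade_le [Finite T] (hE : GradedOrder E) (hA : IsWormFamily E A)
    (hi : IsFirst E A i α) {d : ℕ} (hji : E d j i) (hd : d ≤ m) :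
    ∀ᶠ β in nbhd m α, ¬ Holds (A j) β := by
  by_contra hfreq
  obtain ⟨q, hjq, hq⟩ := hE.exists_plane_top (m + 1) j
  have hAq : Holds (A q) α := (hA q α).2 fun k s hs =>
    frequently_nbhd_of_nbhd (Nat.lt_succ_iff.1 (hq s k hs)) <|
      (not_eventually.1 hfreq).mono fun β hβ =>
        hA.frequently (hA.holds_plane_top hE hjq hq (not_not.1 hβ)) hs
  have hne : ∀ l, E l j q → l ≤ m → False := fun l hl hlm => by
    rcases hjq with rfl | ⟨l', hl', h⟩
    · exact hE.irrefl hl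
    · have := hE.uniq hl h
      omega
  by_cases hqi : q = i
  · subst hqi
    exact hne d hji hd
  · obtain ⟨k, hk | hk⟩ := hE.total hqi
    · exact hi.2 q k hk hAq
    · exact hne _ (hE.comp hji hk) ((min_le_left _ _).trans hd)

theorem eventually_holds [Finite T] (hE : GradedOrder E) (hA : IsWormFamily E A) {q : T}
    (hq : ∀ s k, E k q s → k < m) (h : Holds (A q) α) : ∀ᶠ β in nbhd m α, Holds (A q) β := by
  suffices ∀ᶠ β in nbhd m α, ∀ s k, E k q s → ∃ᶠ ξ in nbhd k β, Holds (A s) ξ from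
    this.mono fun β hβ => (hA q β).2 fun k s => hβ s k
  refine eventually_all.2 fun s => ?_
  by_cases hs : ∃ k, E k q s
  · obtain ⟨k, hk⟩ := hs
    filter_upwards [eventually_holds_dia (hq s k hk) (hA.frequently h hk)] with β hβ l hl
    exact hE.uniq hk hl ▸ hβ
  · exact Eventually.of_forall fun β k hk => (hs ⟨k, hk⟩).elim

theorem eventually_not_isFirst [Finite T] (hE : GradedOrder E) (hA : IsWormFamily E A)
    (hi : Holds (A i) α) {d : ℕ} (hij : E d i j) (hd : d < m) :
    ∀ᶠ β in nbhd m α, ¬ IsFirst E A j β := by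
  obtain ⟨q, hiq, hq⟩ := hE.exists_plane_top m i
  have hne : ∀ l, E l i q → l < m → False := fun l hl hlm => by
    rcases hiq with rfl | ⟨l', hl', h⟩
    · exact hE.irrefl hl
    · have := hE.uniq hl h
      omega
  have hqj : q ≠ j := fun h => hne d (h ▸ hij) hd
  obtain ⟨k, hk⟩ : ∃ k, E k q j := by
    obtain ⟨k, hk | hk⟩ := hE.total hqj
    · exact ⟨k, hk⟩
    · exact (hne _ (hE.comp hij hk) ((min_le_left _ _).trans_lt hd)).elim
  exact (hA.eventually_holds hE hq (hA.holds_plane_top hE hiq hq hi)).mono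
    fun β hβ hj => hj.2 q k hk hβ

theorem eventually_not_of_plane_bottom [Finite T] (hE : GradedOrder E)
    (hA : IsWormFamily E A) (hr : ∀ t, t ≠ r → ∃ k, E k r t) (hi : IsFirst E A i α)
    (hα : ∀ᶠ β in nbhd 0 α, ¬ Holds (A r) β) (hji : j = i ∨ ∃ d, E d j i)
    (hj : ∀ s d, E d s j → d ≤ m) : ∀ᶠ β in nbhd m α, ¬ Holds (A j) β := by
  by_cases hjr : j = r
  · exact hjr ▸ nbhd_antitone α (Nat.zero_le m) hα
  by_contra hfreq
  replace hfreq : ∃ᶠ β in nbhd m α, Holds (A j) β := by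
    simpa only [not_eventually, not_not] using hfreq
  obtain ⟨k, hk⟩ := hr j hjr
  obtain ⟨p, e, he, hp⟩ := hE.exists_pred hk
  have hem := hj p e he
  obtain ⟨l, hl⟩ : ∃ l, E l p i := by
    rcases hji with rfl | ⟨d, hd⟩
    · exact ⟨e, he⟩
    · exact ⟨_, hE.comp he hd⟩
  refine hi.2 p l hl ((hA p α).2 fun k s hs => ?_)
  rcases hp s k hs with rfl | ⟨d, hd⟩
  · obtain rfl := hE.uniq hs he
    exact hfreq.filter_mono (nbhd_antitone α hem)
  · obtain rfl := hE.uniq hs (hE.comp he hd)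
    refine frequently_nbhd_of_nbhd ((min_le_left _ _).trans hem) (hfreq.mono fun β hβ => ?_)
    exact (hA.frequently hβ hd).filter_mono (nbhd_antitone β (min_le_right _ _))

theorem eventually_visible [Finite T] (hE : GradedOrder E) (hA : IsWormFamily E A)
    (hr : ∀ t, t ≠ r → ∃ k, E k r t) (hi : IsFirst E A i α)
    (hα : ∀ᶠ β in nbhd 0 α, ¬ Holds (A r) β) (m : ℕ) :
    ∀ᶠ β in nbhd m α, ∀ j, IsFirst E A j β → Visible E m i j := by
  refine eventually_all.2 fun j => ?_
  by_cases hv : Visible E m i j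
  · exact Eventually.of_forall fun _ _ => hv
  suffices ∀ᶠ β in nbhd m α, ¬ IsFirst E A j β from this.mono fun β hβ h => (hβ h).elim
  have hbottom : (j = i ∨ ∃ d, m < d ∧ E d j i) → ∀ᶠ β in nbhd m α, ¬ IsFirst E A j β := by
    intro hji
    refine (hA.eventually_not_of_plane_bottom hE hr hi hα
      (hji.imp_right fun ⟨d, _, hd⟩ => ⟨d, hd⟩) fun s d hd => ?_).mono fun β hβ h => hβ h.1
    by_contra! hmd
    exact hv (Or.inr ⟨hji, s, d, hmd, hd⟩)
  by_cases hji : j = i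
  · exact hbottom (Or.inl hji)
  · obtain ⟨d, hd | hd⟩ := hE.total hji
    · rcases le_or_gt d m with hdm | hdm
      · exact (hA.eventually_not_of_grade_le hE hi hd hdm).mono fun β hβ h => hβ h.1
      · exact hbottom (Or.inr ⟨d, hdm, hd⟩)
    · rcases lt_or_ge d m with hdm | hdm
      · exact hA.eventually_not_isFirst hE hi.1 hd hdm
      · exact (hv (Or.inl ⟨d, hdm, hd⟩)).elim

theorem frequently_isFirst [Finite T] (hE : GradedOrder E) (hA : IsWormFamily E A)
    (hr : ∀ t, t ≠ r → ∃ k, E k r t) (hi : IsFirst E A i α)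
    (hα : ∀ᶠ β in nbhd 0 α, ¬ Holds (A r) β) (hij : E m i j) :
    ∃ᶠ β in nbhd m α, IsFirst E A j β := by
  have : Nonempty T := ⟨r⟩
  refine ((frequently_nbhd_lob (hA.frequently hi.1 hij)).and_eventually
    (hA.eventually_visible hE hr hi hα m)).mono fun β ⟨⟨hj, hlob⟩, hvis⟩ => ?_
  have hlow : ∀ t d, E d t j → m ≤ d → ¬ Holds (A t) β := fun t d ht hd h =>
    hlob ((hA.frequently h ht).filter_mono (nbhd_antitone β hd))
  obtain ⟨t, ht⟩ := hA.exists_isFirst hE β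
  by_cases htj : t = j
  · exact htj ▸ ht
  exfalso
  obtain ⟨d, hd | hd⟩ := hE.total htj
  · have hdm : d < m := by
      by_contra! hmd
      exact hlow t d hd hmd ht.1
    rcases hvis t ht with ⟨e, he, hit⟩ | ⟨rfl | ⟨e, he, hti⟩, -⟩
    · have := hE.uniq hij (hE.comp hit hd)
      omega
    · exact hdm.ne (hE.uniq hd hij)
    · have := hE.uniq hd (hE.comp hti hij)
      omega
  · exact ht.2 j d hd hj

end IsWormFamily

end GradedOrder

theorem closed_bigConj {l : List Formula} (h : ∀ φ ∈ l, φ.Closed) : (bigConj l).Closed := by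
  induction l with
  | nil => exact trivial
  | cons a l ih =>
    rw [List.forall_mem_cons] at h
    exact ⟨h.1, ih h.2⟩

theorem sat_bigConj {T : Type*} {R : ℕ → T → T → Prop} {V : ℕ → T → Prop} {t : T}
    {l : List Formula} : Sat R V t (bigConj l) ↔ ∀ φ ∈ l, Sat R V t φ := by
  induction l with
  | nil => simp [bigConj, Sat]
  | cons a l ih =>
    rw [List.forall_mem_cons, ← ih]
    rfl

theorem OrdinalModel.holds_bigConj {l : List Formula} {α : Ordinal.{0}} :
    Holds (bigConj l) α ↔ ∀ φ ∈ l, Holds φ α := by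
  induction l with
  | nil => simp [bigConj, Holds]
  | cons a l ih =>
    rw [List.forall_mem_cons, ← ih]
    rfl

theorem sat_restrict {T : Type*} {n : ℕ} {R : ℕ → T → T → Prop} {V : ℕ → T → Prop}
    {φ : Formula} (hφ : φ.InLang n) (t : T) :
    Sat (fun k x y => k < n ∧ R k x y) V t φ ↔ Sat R V t φ := by
  induction φ generalizing t with
  | var i => exact Iff.rfl
  | top => exact Iff.rfl
  | neg a ih => exact not_congr (ih hφ t)
  | and a b iha ihb => exact and_congr (iha hφ.1 t) (ihb hφ.2 t)
  | or a b iha ihb => exact or_congr (iha hφ.1 t) (ihb hφ.2 t)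
  | imp a b iha ihb => exact imp_congr (iha hφ.1 t) (ihb hφ.2 t)
  | box m a ih =>
    exact forall_congr' fun v => imp_congr (and_iff_right hφ.1) (ih hφ.2 v)

theorem Formula.InLang.of_mem_boxedSubs {n : ℕ} {φ : Formula} (hφ : φ.InLang n)
    {p : ℕ × Formula} (hp : p ∈ boxedSubs φ) : (Formula.box p.1 p.2).InLang n := by
  induction φ with
  | var i => exact (List.not_mem_nil hp).elim
  | top => exact (List.not_mem_nil hp).elim
  | neg a ih => exact ih hφ hp
  | and a b iha ihb | or a b iha ihb | imp a b iha ihb =>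
    exact (List.mem_append.1 hp).elim (iha hφ.1) (ihb hφ.2)
  | box m a ih =>
    rcases List.mem_cons.1 hp with rfl | hp
    · exact hφ
    · exact ih hφ.2 hp

/-- At `t`, every boxed subformula `[m]ψ` of `φ` implies `[k]ψ` for all `k ≥ m`. -/
def MonotoneAt {T : Type*} (E : ℕ → T → T → Prop) (V : ℕ → T → Prop) (φ : Formula) (t : T) :
    Prop :=
  ∀ p ∈ boxedSubs φ, ∀ k, p.1 ≤ k → Sat E V t (.box p.1 p.2) → Sat E V t (.box k p.2)

theorem monotoneAt_of_sat_Mform {T : Type*} {n : ℕ} {R : ℕ → T → T → Prop}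
    {V : ℕ → T → Prop} {φ : Formula} (hφ : φ.InLang n) {t : T} (h : Sat R V t (Mform n φ)) :
    MonotoneAt (fun k x y => k < n ∧ R k x y) V φ t := by
  intro p hp k hpk hbox
  rcases hpk.eq_or_lt with rfl | hpk
  · exact hbox
  rintro v ⟨hk, hv⟩
  have hlang := hφ.of_mem_boxedSubs hp
  have himp := sat_bigConj.1 (sat_bigConj.1 h _ (List.mem_map_of_mem hp))
    (.imp (.box p.1 p.2) (.box k p.2))
    (List.mem_map.2 ⟨k, List.mem_range'_1.2 (by omega), rfl⟩)
  exact (sat_restrict hlang.2 v).2 (himp ((sat_restrict hlang t).1 hbox) v hv)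

section GradedOrder

open Filter OrdinalModel

variable {T : Type*} {E : ℕ → T → T → Prop}

open Classical in
theorem GradedOrder.exists_isWormFamily [Fintype T] (hE : GradedOrder E) :
    ∃ A : T → Formula, (∀ t, (A t).Closed) ∧ IsWormFamily E A := by
  let F : ∀ t : T, (∀ s, (∃ k, E k t s) → Formula) → Formula := fun t A =>
    bigConj (Finset.univ.toList.map fun s : T =>
      if h : ∃ k, E k t s then .dia h.choose (A s h) else .top)
  have hfix : ∀ t, hE.wellFounded_gt.fix F t = F t fun s _ => hE.wellFounded_gt.fix F s :=
    hE.wellFounded_gt.fix_eq F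
  refine ⟨hE.wellFounded_gt.fix F, fun t => ?_, fun t α => ?_⟩
  · induction t using hE.wellFounded_gt.induction with
    | _ t ih =>
      rw [hfix]
      refine closed_bigConj fun φ hφ => ?_
      obtain ⟨s, -, rfl⟩ := List.mem_map.1 hφ
      split_ifs with h
      · exact ih s h
      · trivial
  · rw [hfix, holds_bigConj]
    simp only [List.forall_mem_map, Finset.mem_toList, Finset.mem_univ, forall_const]
    rw [forall_comm]
    refine forall_congr' fun s => ?_
    split_ifs with h
    · refine ⟨fun hA k hk => ?_, fun hA => hA _ h.choose_spec⟩
      exact hE.uniq h.choose_spec hk ▸ hA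
    · exact iff_of_true trivial fun k hk => (h ⟨k, hk⟩).elim

theorem IsWormFamily.holds_of_neBot [Finite T] (hE : GradedOrder E) {A : T → Formula}
    (hA : IsWormFamily E A) {n : ℕ} (hn : ∀ k x y, E k x y → k < n) {α : Ordinal.{0}}
    [(nbhd n α).NeBot] (t : T) : Holds (A t) α := by
  induction t using hE.wellFounded_gt.induction with
  | _ t ih =>
    refine (hA t α).2 fun k s hs => ?_
    exact (hA.eventually_holds hE (fun _ _ h => hn _ _ _ h) (ih s ⟨k, hs⟩)).frequently.filter_mono
      (nbhd_antitone α (hn _ _ _ hs).le)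

theorem IsFirst.eq (hE : GradedOrder E) {A : T → Formula} {s t : T} {α : Ordinal.{0}}
    (hs : IsFirst E A s α) (ht : IsFirst E A t α) : s = t := by
  by_contra hne
  obtain ⟨k, hk | hk⟩ := hE.total hne
  · exact ht.2 s k hk hs.1
  · exact hs.2 t k hk ht.1

open Classical in
theorem exists_closed_substitution [Fintype T] (hE : GradedOrder E) {A : T → Formula}
    (hA : ∀ t, (A t).Closed) (V : ℕ → T → Prop) :
    ∃ σ : ℕ → Formula, (∀ i, (σ i).Closed) ∧
      ∀ i t α, IsFirst E A t α → (Holds (σ i) α ↔ V i t) := by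
  let S : T → Formula := fun t => .and (A t)
    (bigConj (Finset.univ.toList.map fun s : T => if ∃ k, E k s t then .neg (A s) else .top))
  have hS : ∀ t α, Holds (S t) α ↔ IsFirst E A t α := by
    refine fun t α => and_congr_right fun _ => ?_
    rw [holds_bigConj]
    simp only [List.forall_mem_map, Finset.mem_toList, Finset.mem_univ, forall_const]
    refine forall_congr' fun s => ?_
    split_ifs with h
    · exact ⟨fun hs _ _ => hs, fun hs => hs _ h.choose_spec⟩
    · exact iff_of_true trivial fun k hk => (h ⟨k, hk⟩).elim
  have hclosed : ∀ t, (S t).Closed := by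
    refine fun t => ⟨hA t, closed_bigConj fun φ hφ => ?_⟩
    obtain ⟨s, -, rfl⟩ := List.mem_map.1 hφ
    split_ifs
    · exact hA s
    · trivial
  refine ⟨fun i => .neg (bigConj (Finset.univ.toList.map fun t : T =>
    if V i t then .neg (S t) else .top)), fun i => ?_, fun i t α ht => ?_⟩
  · refine closed_bigConj fun φ hφ => ?_
    obtain ⟨s, -, rfl⟩ := List.mem_map.1 hφ
    split_ifs
    · exact hclosed s
    · trivial
  · change ¬ Holds (bigConj _) α ↔ _
    rw [holds_bigConj, not_iff_comm]
    simp only [List.forall_mem_map, Finset.mem_toList, Finset.mem_univ, forall_const]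
    refine ⟨fun h s => ?_, fun h hV => ?_⟩
    · split_ifs with hs
      · exact fun hSs => h (((hS s α).1 hSs).eq hE ht ▸ hs)
      · trivial
    · have := h t
      rw [if_pos hV] at this
      exact this ((hS t α).2 ht)

theorem Visible.sat (hE : GradedOrder E) {V : ℕ → T → Prop} {m : ℕ} {ψ : Formula}
    (hmono : ∀ t k, m ≤ k → Sat E V t (.box m ψ) → Sat E V t (.box k ψ)) {i j : T}
    (hv : Visible E m i j) (hi : Sat E V i (.box m ψ)) : Sat E V j ψ := by
  rcases hv with ⟨d, hd, hij⟩ | ⟨hji, s, d, hd, hsj⟩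
  · exact hmono i d hd hi j hij
  · obtain ⟨e, he, hsi⟩ : ∃ e, m < e ∧ E e s i := by
      rcases hji with rfl | ⟨e, he, hji⟩
      · exact ⟨d, hd, hsj⟩
      · exact ⟨_, lt_min hd he, hE.comp hsj hji⟩
    refine hmono s d hd.le (fun t hst => hi t ?_) j hsj
    have hti : t ≠ i := by
      rintro rfl
      exact he.ne (hE.uniq hst hsi)
    obtain ⟨l, hl | hl⟩ := hE.total hti
    · have := hE.uniq hsi (hE.comp hst hl)
      omega
    · have := hE.uniq hst (hE.comp hsi hl)
      obtain rfl : l = m := by omega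
      exact hl

theorem IsWormFamily.holds_subst_iff [Finite T] (hE : GradedOrder E) {A : T → Formula}
    (hA : IsWormFamily E A) {r : T} (hr : ∀ t, t ≠ r → ∃ k, E k r t) {V : ℕ → T → Prop}
    {σ : ℕ → Formula} (hσ : ∀ i t α, IsFirst E A t α → (Holds (σ i) α ↔ V i t))
    {φ : Formula} (hmono : ∀ t, MonotoneAt E V φ t) {t : T} {α : Ordinal.{0}}
    (ht : IsFirst E A t α) (hα : ∀ᶠ β in nbhd 0 α, ¬ Holds (A r) β) :
    Holds (φ.subst σ) α ↔ Sat E V t φ := by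
  have : Nonempty T := ⟨r⟩
  induction φ generalizing t α with
  | var i => exact hσ i t α ht
  | top => exact Iff.rfl
  | neg a ih => exact not_congr (ih hmono ht hα)
  | and a b iha ihb =>
    exact and_congr (iha (fun t p hp => hmono t p (List.mem_append_left _ hp)) ht hα)
      (ihb (fun t p hp => hmono t p (List.mem_append_right _ hp)) ht hα)
  | or a b iha ihb =>
    exact or_congr (iha (fun t p hp => hmono t p (List.mem_append_left _ hp)) ht hα)
      (ihb (fun t p hp => hmono t p (List.mem_append_right _ hp)) ht hα)
  | imp a b iha ihb =>
    exact imp_congr (iha (fun t p hp => hmono t p (List.mem_append_left _ hp)) ht hα)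
      (ihb (fun t p hp => hmono t p (List.mem_append_right _ hp)) ht hα)
  | box m a ih =>
    replace ih := @ih fun t p hp => hmono t p (List.mem_cons_of_mem _ hp)
    have hregion := eventually_nbhd_nbhd (Nat.zero_le m) hα
    refine ⟨fun h s hs => ?_, fun h => ?_⟩
    · obtain ⟨β, hβ, hβr, hβa⟩ := ((hA.frequently_isFirst hE hr ht hα hs).and_eventually
        (hregion.and h)).exists
      exact (ih hβ hβr).1 hβa
    · filter_upwards [hregion, hA.eventually_visible hE hr ht hα m] with β hβr hvis
      obtain ⟨s, hs⟩ := hA.exists_isFirst hE β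
      exact (ih hs hβr).2 ((hvis s hs).sat hE
        (fun t k => hmono t (m, a) List.mem_cons_self k) h)

end GradedOrder

/-- If `φ ∧ M⁺(φ)` holds at the hereditary root of a finite hereditarily
linear `J_n`-frame (under some valuation), then some closed substitution of
`φ` is consistent with `GLP`. -/
theorem closed_substitution_consistent (n : ℕ) {T : Type*} [Fintype T]
    (R : ℕ → T → T → Prop) (hJ : IsJnFrame n R) (hHL : HereditarilyLinear n R)
    (r : T)
    (hroot : ∀ t : T, t ≠ r → Relation.TransGen (fun a b => ∃ k < n, R k a b) r t)
    (V : ℕ → T → Prop) (φ : Formula) (hφ : Formula.InLang n φ)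
    (hsat : Sat R V r (Formula.and φ (Mplus n φ))) :
    ∃ σ : ℕ → Formula, (∀ i, Formula.Closed (σ i)) ∧
      ¬ GLP (Formula.neg (Formula.subst σ φ)) := by
  have hE := hJ.gradedOrder hHL
  set E : ℕ → T → T → Prop := fun k x y => k < n ∧ R k x y
  have hr : ∀ t, t ≠ r → ∃ k, E k r t := fun t ht => by
    induction hroot t ht with
    | single h => exact h
    | @tail b c _ h ih =>
      obtain ⟨k, hk⟩ := h
      by_cases hb : b = r
      · exact ⟨k, hb ▸ hk⟩
      · obtain ⟨l, hl⟩ := ih hb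
        exact ⟨_, hE.comp hl hk⟩
  have hmono : ∀ t, MonotoneAt E V φ t := fun t => by
    refine monotoneAt_of_sat_Mform hφ ?_
    by_cases ht : t = r
    · exact ht ▸ hsat.2.1
    · obtain ⟨k, hk, hrt⟩ := hr t ht
      exact sat_bigConj.1 hsat.2.2 _ (List.mem_map_of_mem (List.mem_range.2 hk)) t hrt
  obtain ⟨A, hclosed, hA⟩ := hE.exists_isWormFamily
  obtain ⟨σ, hσclosed, hσ⟩ := exists_closed_substitution hE hclosed V
  obtain ⟨β, hβ⟩ := OrdinalModel.exists_nbhd_neBot n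
  obtain ⟨α, hαr, hmin⟩ := (wellFounded_lt (α := Ordinal.{0})).has_min
    {α | OrdinalModel.Holds (A r) α} ⟨β, hA.holds_of_neBot hE (fun _ _ _ h => h.1) r⟩
  have hfirst : IsFirst E A r α := ⟨hαr, fun s k hs _ => by
    obtain ⟨l, hl⟩ := hr s (fun h => hE.irrefl (h ▸ hs))
    exact hE.asymm hs hl⟩
  refine ⟨σ, hσclosed, fun hGLP => OrdinalModel.holds_of_GLP hGLP α ?_⟩
  exact (hA.holds_subst_iff hE hr hσ hmono hfirst fun γ hγ h => hmin γ h hγ).2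
    ((sat_restrict hφ r).2 hsat.1)
end
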